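/- arXiv:1804.02473 — 12 statements merged into one kernel-verified Lean document; each statement's English description precedes it below -/
import Mathlib

section
/- Let G be a simple graph of order n with n not congruent to 2 modulo 4. If G is Hamiltonian, then G has a neighborhood-prime labeling. -/
namespace SimpleGraph

open scoped Classical in
/-- A graph of order `n` is *neighborhood-prime* if there is a bijective labeling of the
vertices by `{1, …, n}` such that for every vertex of degree at least 2, the gcd of the
labels appearing in its neighborhood is 1. -/
noncomputable def IsNeighborhoodPrime {V : Type*} [Fintype V] (G : SimpleGraph V) : Prop :=
  ∃ f : V ≃ Fin (Fintype.card V),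
    ∀ v : V, 2 ≤ G.degree v →
      (G.neighborFinset v).gcd (fun u => (f u : ℕ) + 1) = 1

end SimpleGraph

open scoped Classical

/-- If some bijective labeling gives every vertex two neighbors with coprime labels, then the graph
is neighborhood-prime. -/
theorem SimpleGraph.isNeighborhoodPrime_of_exists_coprime {V : Type*} [Fintype V]
    {G : SimpleGraph V} (f : V ≃ Fin (Fintype.card V))
    (h : ∀ v, ∃ u w, G.Adj v u ∧ G.Adj v w ∧ Nat.Coprime ((f u : ℕ) + 1) ((f w : ℕ) + 1)) :
    G.IsNeighborhoodPrime := by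
  refine ⟨f, fun v _ => ?_⟩
  obtain ⟨u, w, hu, hw, huw⟩ := h v
  exact Nat.eq_one_of_dvd_coprimes huw
    (Finset.gcd_dvd ((G.mem_neighborFinset v u).2 hu))
    (Finset.gcd_dvd ((G.mem_neighborFinset v w).2 hw))

/-- Position of `i` when the even numbers below `n` are listed first, followed by the odd ones. -/
def evenOddPosition (n i : ℕ) : ℕ := if i % 2 = 0 then i / 2 else (n + 1) / 2 + i / 2

theorem evenOddPosition_lt {n i : ℕ} (hi : i < n) : evenOddPosition n i < n := by
  unfold evenOddPosition
  split_ifs <;> omega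

theorem evenOddPosition_injOn (n : ℕ) : Set.InjOn (evenOddPosition n) (Set.Iio n) := by
  intro i hi j hj h
  simp only [Set.mem_Iio] at hi hj
  unfold evenOddPosition at h
  split_ifs at h <;> omega

theorem evenOddPosition_add_two (n i : ℕ) :
    evenOddPosition n (i + 2) = evenOddPosition n i + 1 := by
  unfold evenOddPosition
  split_ifs <;> omega

theorem coprime_evenOddPosition_add_two (n i : ℕ) :
    Nat.Coprime (evenOddPosition n i + 1) (evenOddPosition n (i + 2) + 1) := by
  rw [evenOddPosition_add_two]
  simp

theorem coprime_evenOddPosition_one_pred {n : ℕ} (hn : n % 4 ≠ 2) (hpos : 0 < n) :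
    Nat.Coprime (evenOddPosition n 1 + 1) (evenOddPosition n (n - 1) + 1) := by
  rcases Nat.even_or_odd n with ⟨m, rfl⟩ | ⟨m, rfl⟩
  · have h1 : evenOddPosition (m + m) 1 = m := by simp [evenOddPosition]; omega
    have h2 : evenOddPosition (m + m) (m + m - 1) + 1 = m * 2 := by
      unfold evenOddPosition
      split_ifs <;> omega
    rw [h1, h2]
    refine Nat.Coprime.mul_right (by simp) ?_
    exact Nat.coprime_two_right.2 (Nat.odd_iff.2 (by omega))
  · have h1 : evenOddPosition (2 * m + 1) 1 = m + 1 := by simp [evenOddPosition]; omega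
    have h2 : evenOddPosition (2 * m + 1) (2 * m + 1 - 1) = m := by simp [evenOddPosition]
    rw [h1, h2]
    simp

/-- Let G be a simple graph of order n with n not congruent to 2 modulo 4.
If G is Hamiltonian, then G has a neighborhood-prime labeling. -/
theorem hamiltonian_isNeighborhoodPrime {V : Type*} [Fintype V] (G : SimpleGraph V)
    (hn : Fintype.card V % 4 ≠ 2)
    (hham : ∃ (a : V) (p : G.Walk a a), p.IsHamiltonianCycle) :
    G.IsNeighborhoodPrime := by
  obtain ⟨a, p, hp⟩ := hham
  have hlen : p.length = Fintype.card V := hp.length_eq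
  have hthree : 3 ≤ Fintype.card V := hlen ▸ hp.isCycle.three_le_length
  have hbij : Function.Bijective fun i : Fin (Fintype.card V) => p.getVert i := by
    refine (Fintype.bijective_iff_injective_and_card _).2 ⟨fun i j hij => ?_, by simp⟩
    exact Fin.ext (hp.isCycle.getVert_injOn' (by simp; omega) (by simp; omega) hij)
  have hperm : Function.Bijective fun i : Fin (Fintype.card V) =>
      (⟨evenOddPosition (Fintype.card V) i, evenOddPosition_lt i.2⟩ : Fin (Fintype.card V)) :=
    Finite.injective_iff_bijective.1 fun i j hij =>
      Fin.ext (evenOddPosition_injOn _ i.2 j.2 (Fin.mk.inj_iff.1 hij))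
  let e := Equiv.ofBijective _ hbij
  let f := e.symm.trans (Equiv.ofBijective _ hperm)
  have hf (i : ℕ) (hi : i < Fintype.card V) :
      (f (p.getVert i) : ℕ) = evenOddPosition (Fintype.card V) i := by
    have he : e.symm (p.getVert i) = ⟨i, hi⟩ := e.symm_apply_eq.2 rfl
    simp [f, he]
  have hadj (i : ℕ) (hi : i < Fintype.card V) : G.Adj (p.getVert i) (p.getVert (i + 1)) :=
    p.adj_getVert_succ (hlen ▸ hi)
  have hclose : G.Adj (p.getVert (Fintype.card V - 1)) (p.getVert 0) := by
    rw [p.getVert_zero]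
    have h := hadj (Fintype.card V - 1) (by omega)
    rwa [Nat.sub_add_cancel (by omega), p.getVert_of_length_le hlen.le] at h
  refine SimpleGraph.isNeighborhoodPrime_of_exists_coprime f fun v => ?_
  obtain ⟨⟨i, hi⟩, rfl⟩ := hbij.surjective v
  rcases i with _ | i
  · refine ⟨_, _, hadj 0 hi, hclose.symm, ?_⟩
    rw [hf _ (by omega), hf _ (by omega)]
    exact coprime_evenOddPosition_one_pred hn hi
  · by_cases hlast : i + 2 < Fintype.card V
    · refine ⟨_, _, (hadj i (by omega)).symm, hadj (i + 1) hi, ?_⟩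
      rw [hf _ (by omega), hf _ hlast]
      exact coprime_evenOddPosition_add_two _ i
    · have hi' : Fintype.card V - 1 = i + 1 := by omega
      refine ⟨_, _, (hadj i (by omega)).symm, hi' ▸ hclose, ?_⟩
      rw [hf _ (by omega), hf _ (by omega)]
      simp [evenOddPosition]
end

section
/- If a simple graph G contains a Hamilton cycle C and a chord of C that forms a cycle of length 4k, for some positive integer k, using only the chord and edges from C, then G is neighborhood-prime. -/
namespace SimpleGraph

/-- The label, counted from `0`, of the `i`-th vertex of a Hamilton cycle of length `n`. Vertices at
distance two along the cycle mostly receive consecutive labels. -/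
def alternatingLabel (n i : ℕ) : ℕ := if i % 2 = 1 then i / 2 else n / 2 + i / 2

lemma alternatingLabel_lt {n i : ℕ} (h : i < n) : alternatingLabel n i < n := by
  unfold alternatingLabel; split_ifs <;> omega

lemma alternatingLabel_injOn {n i j : ℕ} (hi : i < n) (hj : j < n)
    (h : alternatingLabel n i = alternatingLabel n j) : i = j := by
  unfold alternatingLabel at h; split_ifs at h <;> omega

/-- A common divisor of the labels on the cyclic neighbors of position `i`, and of the label of the
chord end `q` when `i` is the last position and `n ≡ 2 [MOD 4]`, is `1`. -/
lemma eq_one_of_dvd_alternatingLabel {n i d : ℕ} (hn : 3 ≤ n) (hi : i < n)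
    (hsucc : i + 1 < n → d ∣ alternatingLabel n (i + 1) + 1)
    (hpred : 0 < i → d ∣ alternatingLabel n (i - 1) + 1)
    (hlast : i = n - 1 → d ∣ alternatingLabel n 0 + 1)
    (hchord : i = n - 1 → n % 4 = 2 → ∃ q, q % 4 = 2 ∧ d ∣ alternatingLabel n q + 1) :
    d = 1 := by
  have key : ∀ a b : ℕ, d ∣ a → d ∣ b → b = a + 1 → d = 1 := by
    rintro a b ha hb rfl
    exact Nat.dvd_one.1 ((Nat.dvd_add_right ha).1 hb)
  have one : ∀ a : ℕ, d ∣ a → a = 1 → d = 1 := by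
    rintro a ha rfl
    exact Nat.dvd_one.1 ha
  rcases Nat.eq_zero_or_pos i with rfl | hi0
  · refine one _ (hsucc (by omega)) ?_
    simp [alternatingLabel]
  rcases lt_or_ge (i + 1) n with hi1 | hi1
  · refine key _ _ (hpred hi0) (hsucc hi1) ?_
    unfold alternatingLabel; split_ifs <;> omega
  obtain rfl : i = n - 1 := by omega
  have h1 := hpred hi0
  have h0 := hlast rfl
  have e0 : alternatingLabel n 0 + 1 = n / 2 + 1 := by simp [alternatingLabel]
  rw [e0] at h0
  rcases Nat.mod_two_eq_zero_or_one n with he | ho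
  · have e1 : alternatingLabel n (n - 1 - 1) + 1 = 2 * (n / 2) := by
      unfold alternatingLabel; split_ifs <;> omega
    rw [e1] at h1
    have h2 : d ∣ 2 := by
      refine (Nat.dvd_add_right h1).1 ?_
      have := h0.mul_left 2
      rwa [mul_add, mul_one] at this
    suffices ∃ m, m % 2 = 1 ∧ d ∣ m by
      obtain ⟨m, hm, hdm⟩ := this
      have h3 : d ∣ 2 * (m / 2) := h2.mul_right _
      exact key _ _ h3 hdm (by omega)
    by_cases h4 : n % 4 = 2
    · obtain ⟨q, hq, hdq⟩ := hchord rfl h4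
      refine ⟨_, ?_, hdq⟩
      unfold alternatingLabel; split_ifs <;> omega
    · exact ⟨_, by omega, h0⟩
  · refine key _ _ h1 h0 ?_
    unfold alternatingLabel; split_ifs <;> omega

lemma isNeighborhoodPrime_of_cyclic_enumeration {V : Type*} [Fintype V] (G : SimpleGraph V)
    (hn : 3 ≤ Fintype.card V) (e : ℕ → V)
    (hinj : ∀ i < Fintype.card V, ∀ j < Fintype.card V, e i = e j → i = j)
    (hadj : ∀ i, i + 1 < Fintype.card V → G.Adj (e i) (e (i + 1)))
    (hlast : G.Adj (e (Fintype.card V - 1)) (e 0))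
    (hchord : Fintype.card V % 4 = 2 →
      ∃ q < Fintype.card V, q % 4 = 2 ∧ G.Adj (e (Fintype.card V - 1)) (e q)) :
    G.IsNeighborhoodPrime := by
  classical
  set n := Fintype.card V with hcard
  let E : Fin n ≃ V := Equiv.ofBijective (fun i => e i)
    ((Fintype.bijective_iff_injective_and_card _).2
      ⟨fun i j h => Fin.ext (hinj i i.2 j j.2 h), by simp [hcard]⟩)
  let P : Fin n ≃ Fin n := Equiv.ofBijective
    (fun i => ⟨alternatingLabel n i, alternatingLabel_lt i.2⟩)
    (Finite.injective_iff_bijective.1 fun i j h =>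
      Fin.ext (alternatingLabel_injOn i.2 j.2 (Fin.ext_iff.1 h)))
  have hf : ∀ j < n, ((E.symm.trans P) (e j) : ℕ) = alternatingLabel n j := by
    intro j hj
    have : E.symm (e j) = ⟨j, hj⟩ := (Equiv.symm_apply_eq E).2 rfl
    simp [this, P]
  refine ⟨E.symm.trans P, fun v _ => ?_⟩
  obtain ⟨⟨i, hi⟩, rfl⟩ := E.surjective v
  have hd : ∀ j < n, G.Adj (e i) (e j) →
      (G.neighborFinset (e i)).gcd (fun u => ((E.symm.trans P) u : ℕ) + 1) ∣
        alternatingLabel n j + 1 := by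
    intro j hj h
    rw [← hf j hj]
    exact Finset.gcd_dvd (f := fun u => ((E.symm.trans P) u : ℕ) + 1)
      ((G.mem_neighborFinset _ _).2 h)
  have hgoal := eq_one_of_dvd_alternatingLabel hn hi
    (fun h => hd _ h (hadj i h))
    (fun h => hd _ (by omega) (by
      have := hadj (i - 1) (by omega)
      rw [Nat.sub_add_cancel h] at this
      exact this.symm))
    (fun h => hd _ (by omega) (h ▸ hlast))
    (fun h h2 => by
      obtain ⟨q, hq, hq4, hqa⟩ := hchord h2
      exact ⟨q, hq4, hd q hq (h ▸ hqa)⟩)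
  convert hgoal
  rfl

lemma Walk.IsCycle.exists_zmod_enumeration {V : Type*} {G : SimpleGraph V} {u : V}
    {p : G.Walk u u} (hp : p.IsCycle) :
    ∃ g : ZMod p.length → V, Function.Injective g ∧
      ∀ a b, s(a, b) ∈ p.edges ↔ ∃ i, s(g i, g (i + 1)) = s(a, b) := by
  have h3 := hp.three_le_length
  have : NeZero p.length := ⟨by omega⟩
  have : Fact (1 < p.length) := ⟨by omega⟩
  have hsucc : ∀ i : ZMod p.length, p.getVert (i + 1).val = p.getVert (i.val + 1) := by
    intro i
    have hi := i.val_lt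
    rw [ZMod.val_add, ZMod.val_one]
    rcases Nat.lt_or_ge (i.val + 1) p.length with h | h
    · rw [Nat.mod_eq_of_lt h]
    · have h' : i.val + 1 = p.length := by omega
      simp [h']
  refine ⟨fun i => p.getVert i.val, fun i j h => ?_, fun a b => ?_⟩
  · have hi := i.val_lt
    have hj := j.val_lt
    exact ZMod.val_injective _ (hp.getVert_injOn' (by simp; omega) (by simp; omega) h)
  · rw [p.mk_mem_edges_iff_exists]
    constructor
    · rintro ⟨i, hi, h⟩
      refine ⟨(i : ZMod p.length), ?_⟩
      simp only [hsucc, ZMod.val_natCast_of_lt hi, h]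
    · rintro ⟨i, h⟩
      exact ⟨i.val, i.val_lt, by simpa only [← hsucc] using h⟩

/-- A walk with unit steps in a commutative ring that never immediately turns back has constant
direction. -/
lemma exists_direction_of_unit_steps {R : Type*} [CommRing R] (P : ℕ → R) (m : ℕ)
    (hstep : ∀ i < m, P (i + 1) = P i + 1 ∨ P (i + 1) = P i - 1)
    (hback : ∀ i, i + 2 ≤ m → P (i + 2) ≠ P i) :
    P m = P 0 + m ∨ P m = P 0 - m := by
  have main : ∀ ε : R, (∀ i < m, P (i + 1) = P i + ε ∨ P (i + 1) = P i - ε) →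
      (0 < m → P 1 = P 0 + ε) → ∀ i, i ≤ m → P i = P 0 + i * ε ∧ (i < m → P (i + 1) = P i + ε) := by
    intro ε hε h0 i
    induction i with
    | zero => intro _; simpa using h0
    | succ i ih =>
      intro hi
      obtain ⟨h1, h2⟩ := ih (by omega)
      have h3 := h2 (by omega)
      refine ⟨by rw [h3, h1]; push_cast; ring, fun hlt => ?_⟩
      refine (hε _ hlt).resolve_right fun h => hback i (by omega) ?_
      rw [h, h3]; ring
  rcases Nat.eq_zero_or_pos m with rfl | hm
  · simp
  rcases hstep 0 hm with h | h
  · left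
    simpa using (main 1 hstep (fun _ => h) m le_rfl).1
  · right
    have := (main (-1) (fun i hi => by
      simpa [sub_eq_add_neg, or_comm] using hstep i hi)
      (fun _ => by simpa [sub_eq_add_neg] using h) m le_rfl).1
    rw [this]; ring

/-- The path obtained by deleting from a cycle of length `m ≥ 3` the edge `ab`, if it is carried by
a cyclic enumeration `g`, joins two vertices at cyclic distance `m - 1`. -/
lemma exists_chord_positions {V : Type*} {n m : ℕ} (hm : 3 ≤ m) {g : ZMod n → V}
    (hg : Function.Bijective g) {h : ZMod m → V} (hh : Function.Injective h) {a b : V}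
    (hab : ∃ t, s(h t, h (t + 1)) = s(a, b))
    (hedges : ∀ i, s(h i, h (i + 1)) = s(a, b) ∨ ∃ j, s(g j, g (j + 1)) = s(h i, h (i + 1))) :
    ∃ α : ZMod n, s(g α, g (α + (m - 1 : ℕ))) = s(a, b) := by
  obtain ⟨t, ht⟩ := hab
  let E := Equiv.ofBijective g hg
  have hE : ∀ v, g (E.symm v) = v := E.apply_symm_apply
  have hcast : ∀ i : ℕ, 0 < i → i < m → (i : ZMod m) ≠ 0 := by
    intro i hi0 him h0
    have := Nat.le_of_dvd hi0 ((ZMod.natCast_eq_zero_iff i m).1 h0)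
    omega
  let P : ℕ → ZMod n := fun i => E.symm (h (t + 1 + i))
  have hgP : ∀ i, g (P i) = h (t + 1 + i) := fun i => hE _
  have hstep : ∀ i < m - 1, P (i + 1) = P i + 1 ∨ P (i + 1) = P i - 1 := by
    intro i hi
    have hne : s(h (t + 1 + i), h (t + 1 + i + 1)) ≠ s(a, b) := by
      rw [← ht]
      intro heq
      rcases Sym2.eq_iff.1 heq with ⟨h1, -⟩ | ⟨h1, h2⟩
      · refine hcast (i + 1) (by omega) (by omega) ?_
        push_cast
        linear_combination hh h1
      · refine hcast 2 (by omega) (by omega) ?_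
        push_cast
        linear_combination hh h2 - hh h1
    obtain ⟨j, hj⟩ := (hedges _).resolve_left hne
    have e1 : h (t + 1 + i + 1) = g (P (i + 1)) := by
      rw [hgP]; push_cast; rw [add_assoc (t + 1)]
    rw [e1, ← hgP] at hj
    rcases Sym2.eq_iff.1 hj with ⟨h1, h2⟩ | ⟨h1, h2⟩
    · left
      rw [← hg.1 h1, ← hg.1 h2]
    · right
      rw [← hg.1 h1, ← hg.1 h2]; ring
  have hback : ∀ i, i + 2 ≤ m - 1 → P (i + 2) ≠ P i := by
    intro i hi h2
    have h3 := hh (E.symm.injective h2)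
    refine hcast 2 (by omega) (by omega) ?_
    push_cast at h3 ⊢
    linear_combination h3
  have h0 : g (P 0) = h (t + 1) := by rw [hgP]; simp
  have hlast : g (P (m - 1)) = h t := by
    rw [hgP]
    congr 1
    rw [Nat.cast_sub (by omega)]
    simp
  rcases exists_direction_of_unit_steps P (m - 1) hstep hback with hP | hP
  · exact ⟨P 0, by rw [← hP, h0, hlast, ← ht, Sym2.eq_swap]⟩
  · refine ⟨P (m - 1), ?_⟩
    rw [show P (m - 1) + ((m - 1 : ℕ) : ZMod n) = P 0 by rw [hP]; ring, h0, hlast, ht]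

end SimpleGraph

open scoped Classical

/-- If a simple graph G contains a Hamilton cycle C and a chord of C that
forms a cycle of length 4k, for some positive integer k, using only the chord and edges
from C, then G is neighborhood-prime. -/
theorem hamiltonian_chord_cycle_isNeighborhoodPrime {V : Type*} [Fintype V]
    (G : SimpleGraph V)
    (v₀ : V) (p : G.Walk v₀ v₀) (hp : p.IsHamiltonianCycle)
    (a b : V) (hab : G.Adj a b) (hchord : s(a, b) ∉ p.edges)
    (k : ℕ) (hk : 0 < k) (x : V) (c : G.Walk x x) (hc : c.IsCycle)
    (hlen : c.length = 4 * k)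
    (hchord_mem : s(a, b) ∈ c.edges)
    (hedges : ∀ e ∈ c.edges, e = s(a, b) ∨ e ∈ p.edges) :
    G.IsNeighborhoodPrime := by
  have hpc := hp.isCycle
  have hcard : p.length = Fintype.card V := hp.length_eq
  have hn := hpc.three_le_length
  obtain ⟨g, hg, hgE⟩ := hpc.exists_zmod_enumeration
  obtain ⟨h, hh, hhE⟩ := hc.exists_zmod_enumeration
  have : NeZero p.length := ⟨by omega⟩
  have : NeZero c.length := ⟨by omega⟩
  have hgb : Function.Bijective g :=
    (Fintype.bijective_iff_injective_and_card g).2 ⟨hg, by rw [ZMod.card, hcard]⟩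
  have hle : c.length ≤ p.length := by
    have := Fintype.card_le_of_injective h hh
    rwa [ZMod.card, ← hcard] at this
  obtain ⟨α, hα⟩ := SimpleGraph.exists_chord_positions (by omega) hgb hh
    ((hhE a b).1 hchord_mem) (fun i => by
      have := hedges _ ((hhE _ _).2 ⟨i, rfl⟩)
      rwa [hgE] at this)
  have hadj : ∀ i, G.Adj (g i) (g (i + 1)) := fun i =>
    p.adj_of_mem_edges ((hgE _ _).2 ⟨i, rfl⟩)
  have hchordAdj : G.Adj (g α) (g (α + (c.length - 1 : ℕ))) := by
    rw [← SimpleGraph.mem_edgeSet, hα]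
    exact hab
  have hpos : α + 1 + ((p.length - 1 : ℕ) : ZMod p.length) = α := by
    rw [Nat.cast_sub (by omega)]
    simp
  refine G.isNeighborhoodPrime_of_cyclic_enumeration (by omega)
    (fun i => g (α + 1 + i)) ?_ ?_ ?_ ?_ <;> rw [← hcard]
  · intro i hi j hj hij
    have := congrArg ZMod.val (add_left_cancel (hg hij))
    rwa [ZMod.val_natCast_of_lt hi, ZMod.val_natCast_of_lt hj] at this
  · intro i _
    have := hadj (α + 1 + i)
    rw [add_assoc (α + 1)] at this
    simpa only [Nat.cast_add, Nat.cast_one] using this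
  · simpa [hpos] using hadj α
  · intro _
    refine ⟨c.length - 2, by omega, by omega, ?_⟩
    have e : α + 1 + ((c.length - 2 : ℕ) : ZMod p.length) = α + (c.length - 1 : ℕ) := by
      rw [show c.length - 1 = 1 + (c.length - 2) by omega]
      push_cast
      ring
    simpa only [hpos, e] using hchordAdj
end

section
/- If a simple graph G is Hamiltonian and contains a cycle of odd length, then G is neighborhood-prime. -/
namespace SimpleGraph

variable {V : Type*} {G : SimpleGraph V}

/-- A labeling of a cyclic enumeration of the vertices in which every vertex has two neighbors with
coprime labels yields a neighborhood-prime labeling. -/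
theorem isNeighborhoodPrime_of_coprime_labels [Fintype V] {w : ℕ → V}
    (hper : Function.Periodic w (Fintype.card V)) (hsurj : Function.Surjective w) (L : ℕ → ℕ)
    (hL : ∀ i < Fintype.card V, 1 ≤ L i ∧ L i ≤ Fintype.card V)
    (hinj : ∀ i < Fintype.card V, ∀ j < Fintype.card V, L i = L j → i = j)
    (hcop : ∀ i < Fintype.card V, ∃ j < Fintype.card V, ∃ k < Fintype.card V,
      G.Adj (w i) (w j) ∧ G.Adj (w i) (w k) ∧ (L j).Coprime (L k)) :
    G.IsNeighborhoodPrime := by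
  classical
  rcases isEmpty_or_nonempty V with hV | hV
  · exact ⟨Fintype.equivFin V, fun v => hV.elim v⟩
  have hn : 0 < Fintype.card V := Fintype.card_pos
  have hsurj' : Function.Surjective (fun i : Fin (Fintype.card V) => w i) := fun v => by
    obtain ⟨k, rfl⟩ := hsurj v
    exact ⟨⟨k % _, Nat.mod_lt _ hn⟩, hper.map_mod_nat k⟩
  let e : Fin (Fintype.card V) ≃ V := Equiv.ofBijective _
    ((Fintype.bijective_iff_surjective_and_card _).2 ⟨hsurj', by simp⟩)
  have he : ∀ i (hi : i < Fintype.card V), e.symm (w i) = ⟨i, hi⟩ := fun i hi =>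
    e.symm_apply_eq.2 rfl
  let l : Fin (Fintype.card V) → Fin (Fintype.card V) := fun i =>
    ⟨L i - 1, by have := hL i i.2; omega⟩
  have hl : Function.Injective l := fun i j h => by
    have h' : L i - 1 = L j - 1 := congrArg Fin.val h
    have h₁ := hL i i.2
    have h₂ := hL j j.2
    exact Fin.ext (hinj i i.2 j j.2 (by omega))
  let f := e.symm.trans (Equiv.ofBijective l (Finite.injective_iff_bijective.1 hl))
  have hf : ∀ i < Fintype.card V, (f (w i) : ℕ) + 1 = L i := fun i hi => by
    have h₁ := hL i hi
    have h₂ : (f (w i) : ℕ) = L i - 1 := by simp [f, he i hi, l]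
    omega
  refine ⟨f, fun v _ => ?_⟩
  obtain ⟨⟨i, hi⟩, rfl⟩ := hsurj' v
  obtain ⟨j, hj, k, hk, hij, hik, hjk⟩ := hcop i hi
  refine Nat.eq_one_of_dvd_coprimes hjk ?_ ?_
  · rw [← hf j hj]
    exact Finset.gcd_dvd (f := fun u => (f u : ℕ) + 1) ((G.mem_neighborFinset _ _).2 hij)
  · rw [← hf k hk]
    exact Finset.gcd_dvd (f := fun u => (f u : ℕ) + 1) ((G.mem_neighborFinset _ _).2 hik)

theorem isNeighborhoodPrime_of_odd_card [Fintype V] {w : ℕ → V}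
    (hper : Function.Periodic w (Fintype.card V)) (hsurj : Function.Surjective w)
    (hadj : ∀ i, G.Adj (w i) (w (i + 1))) (hodd : Odd (Fintype.card V)) :
    G.IsNeighborhoodPrime := by
  obtain ⟨m, hm⟩ := hodd
  have hlast : w (2 * m + 1) = w 0 := by simpa [hm] using hper 0
  have hm0 : m ≠ 0 := by
    rintro rfl
    exact (hadj 0).ne (by simpa using hlast.symm)
  refine isNeighborhoodPrime_of_coprime_labels hper hsurj
    (fun i => if i % 2 = 0 then i / 2 + 1 else m + 2 + i / 2) ?_ ?_ ?_
  · intro i hi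
    split_ifs <;> omega
  · intro i hi j hj h
    split_ifs at h <;> omega
  · intro i hi
    rcases Nat.eq_zero_or_pos i with rfl | hpos
    · refine ⟨1, by omega, 2 * m, by omega, hadj 0, hlast ▸ (hadj (2 * m)).symm, ?_⟩
      simp [show m + 2 = (m + 1) + 1 from rfl]
    obtain ⟨i, rfl⟩ : ∃ k, i = k + 1 := ⟨i - 1, by omega⟩
    rcases eq_or_ne (i + 1) (2 * m) with h | h
    · refine ⟨i, by omega, 0, by omega, (hadj i).symm, ?_, by simp⟩
      rw [← hlast, ← h]
      exact hadj _
    · refine ⟨i, by omega, i + 2, by omega, (hadj i).symm, hadj _, ?_⟩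
      have h₁ : (i + 2) / 2 = i / 2 + 1 := by omega
      have h₂ : (i + 2) % 2 = i % 2 := by omega
      rw [h₁, h₂]
      split_ifs
      · simp
      · simp [← add_assoc]

theorem isNeighborhoodPrime_of_adj_even [Fintype V] {w : ℕ → V} {m b : ℕ}
    (hper : Function.Periodic w (Fintype.card V)) (hsurj : Function.Surjective w)
    (hadj : ∀ i, G.Adj (w i) (w (i + 1))) (hm : Fintype.card V = 2 * m) (hb : b < m)
    (hchord : G.Adj (w 0) (w (2 * b))) :
    G.IsNeighborhoodPrime := by
  have hlast : w (2 * m) = w 0 := by simpa [hm] using hper 0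
  have hb0 : b ≠ 0 := by
    rintro rfl
    exact hchord.ne rfl
  refine isNeighborhoodPrime_of_coprime_labels hper hsurj
    (fun i => if i % 2 = 0 then if b ≤ i / 2 then i / 2 - b + 1 else i / 2 + m - b + 1
      else m + 1 + i / 2) ?_ ?_ ?_
  · intro i hi
    split_ifs <;> omega
  · intro i hi j hj h
    split_ifs at h <;> omega
  · intro i hi
    rcases Nat.eq_zero_or_pos i with rfl | hpos
    · exact ⟨1, by omega, 2 * b, by omega, hadj 0, hchord, by simp⟩
    obtain ⟨i, rfl⟩ : ∃ k, i = k + 1 := ⟨i - 1, by omega⟩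
    rcases eq_or_ne (i + 2) (2 * m) with h | h
    · refine ⟨i, by omega, 0, by omega, (hadj i).symm, ?_, ?_⟩
      · rw [← hlast, ← h]
        exact hadj _
      · have h₁ : i % 2 = 0 := by omega
        have h₂ : 0 + m - b + 1 = i / 2 - b + 1 + 1 := by omega
        simp only [h₁, if_pos (show b ≤ i / 2 by omega), Nat.zero_mod, Nat.zero_div, if_true,
          if_neg (show ¬ b ≤ 0 by omega), h₂]
        simp
    · refine ⟨i, by omega, i + 2, by omega, (hadj i).symm, hadj _, ?_⟩
      have h₁ : (i + 2) / 2 = i / 2 + 1 := by omega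
      have h₂ : (i + 2) % 2 = i % 2 := by omega
      rw [h₁, h₂]
      split_ifs with h₃ h₄ h₅ h₅
      · simp [show i / 2 + 1 - b + 1 = i / 2 - b + 1 + 1 by omega]
      · omega
      · simp [show i / 2 + 1 - b + 1 = 1 by omega]
      · simp [show i / 2 + 1 + m - b + 1 = i / 2 + m - b + 1 + 1 by omega]
      · simp [← add_assoc]

/-- Any enumeration of the vertices of a non-bipartite graph has two adjacent vertices whose indices
have the same parity. -/
theorem exists_adj_mod_two_eq {w : ℕ → V} {n : ℕ} (hw : ∀ v, ∃ i < n, w i = v)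
    {x : V} {c : G.Walk x x} (hc : Odd c.length) :
    ∃ i < n, ∃ j < n, i < j ∧ i % 2 = j % 2 ∧ G.Adj (w i) (w j) := by
  by_contra! hno
  choose g hg hwg using hw
  have hcol : ∀ {u v}, G.Adj u v → decide (g u % 2 = 0) ≠ decide (g v % 2 = 0) := by
    intro u v huv
    have h₁ : g u ≠ g v := fun h => huv.ne (by rw [← hwg u, ← hwg v, h])
    have h₂ : g u % 2 ≠ g v % 2 := fun h => by
      rcases h₁.lt_or_gt with h' | h'
      · exact hno _ (hg u) _ (hg v) h' h (by rwa [hwg, hwg])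
      · exact hno _ (hg v) _ (hg u) h' h.symm (by rw [hwg, hwg]; exact huv.symm)
    simp only [ne_eq, decide_eq_decide]
    omega
  exact (Nat.not_even_iff_odd.2 hc)
    (((Coloring.mk (fun v => decide (g v % 2 = 0)) hcol).even_length_iff_congr c).2 Iff.rfl)

/-- A Hamiltonian cycle gives a periodic enumeration of the vertices along edges. -/
theorem Walk.IsHamiltonianCycle.exists_periodic [Fintype V] [DecidableEq V] {a : V}
    {p : G.Walk a a} (hp : p.IsHamiltonianCycle) :
    ∃ w : ℕ → V, Function.Periodic w (Fintype.card V) ∧ Function.Surjective w ∧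
      ∀ i, G.Adj (w i) (w (i + 1)) := by
  have hn : 0 < p.length := by have := hp.isCycle.three_le_length; omega
  rw [← hp.length_eq]
  have hlen : ∀ i ≤ p.length, p.getVert (i % p.length) = p.getVert i := fun i hi => by
    rcases hi.lt_or_eq with h | rfl
    · rw [Nat.mod_eq_of_lt h]
    · simp
  refine ⟨fun i => p.getVert (i % p.length), fun i => by simp, fun v => ?_, fun i => ?_⟩
  · obtain ⟨i, rfl, hi⟩ := Walk.mem_support_iff_exists_getVert.1 (hp.mem_support v)
    exact ⟨i, hlen i hi⟩
  · have hi := Nat.mod_lt i hn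
    dsimp only
    rw [← Nat.mod_add_mod, hlen _ hi]
    exact p.adj_getVert_succ hi

end SimpleGraph

open scoped Classical

/-- If a simple graph G is Hamiltonian and contains a cycle of odd length,
then G is neighborhood-prime. -/
theorem hamiltonian_oddCycle_isNeighborhoodPrime {V : Type*} [Fintype V]
    (G : SimpleGraph V)
    (hham : ∃ (a : V) (p : G.Walk a a), p.IsHamiltonianCycle)
    (hodd : ∃ (x : V) (c : G.Walk x x), c.IsCycle ∧ Odd c.length) :
    G.IsNeighborhoodPrime := by
  obtain ⟨a, p, hp⟩ := hham
  obtain ⟨x, c, -, hc⟩ := hodd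
  obtain ⟨w, hper, hsurj, hadj⟩ := hp.exists_periodic
  rcases Nat.even_or_odd' (Fintype.card V) with ⟨m, hm | hm⟩
  · have hpos : 0 < Fintype.card V := Fintype.card_pos_iff.2 ⟨a⟩
    obtain ⟨i, hi, j, hj, hij, hpar, hchord⟩ := SimpleGraph.exists_adj_mod_two_eq
      (n := Fintype.card V) (w := w) (fun v => by
        obtain ⟨k, rfl⟩ := hsurj v
        exact ⟨k % _, Nat.mod_lt _ hpos, hper.map_mod_nat k⟩) hc
    refine SimpleGraph.isNeighborhoodPrime_of_adj_even (w := fun k => w (k + i)) (m := m)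
      (b := (j - i) / 2) (fun k => ?_) (fun v => ?_) (fun k => ?_) hm (by omega) ?_
    · dsimp only
      rw [add_right_comm]
      exact hper _
    · obtain ⟨k, rfl⟩ := hsurj v
      refine ⟨k % Fintype.card V + (Fintype.card V - i), ?_⟩
      dsimp only
      rw [add_assoc, Nat.sub_add_cancel hi.le, hper, hper.map_mod_nat]
    · rw [add_right_comm]
      exact hadj _
    · have h : 2 * ((j - i) / 2) + i = j := by omega
      simpa [h] using hchord
  · exact SimpleGraph.isNeighborhoodPrime_of_odd_card hper hsurj hadj ⟨m, hm⟩
end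

section
/- Every connected simple graph of order n with n not congruent to 3 modulo 4 whose circumference equals n − 1 is neighborhood-prime. -/
namespace SimpleGraph

/-- For `m` not congruent to 2 modulo 4, the zero-based label of the `i`-th vertex of a cycle of
length `m` in a neighborhood-prime labeling: number the vertices in even position first, then
those in odd position. -/
def cycleLabel (m i : ℕ) : ℕ :=
  if i = m then m else if i % 2 = 0 then i / 2 else (m + 1) / 2 + i / 2

lemma cycleLabel_zero (m : ℕ) : cycleLabel m 0 = 0 := by
  unfold cycleLabel; grind

lemma cycleLabel_lt {m i : ℕ} (hi : i < m + 1) : cycleLabel m i < m + 1 := by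
  unfold cycleLabel; grind

lemma cycleLabel_injOn {m i j : ℕ} (hi : i < m + 1) (hj : j < m + 1)
    (h : cycleLabel m i = cycleLabel m j) : i = j := by
  unfold cycleLabel at h; grind

lemma cycleLabel_add_two {m i : ℕ} (hi : i + 2 < m) :
    cycleLabel m (i + 2) = cycleLabel m i + 1 := by
  unfold cycleLabel; grind

lemma coprime_cycleLabel_one {m : ℕ} (hm : 3 ≤ m) (h4 : m % 4 ≠ 2) :
    Nat.Coprime (cycleLabel m 1 + 1) (cycleLabel m (m - 1) + 1) := by
  rcases Nat.even_or_odd' m with ⟨k, rfl | rfl⟩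
  · have h1 : cycleLabel (2 * k) 1 + 1 = k + 1 := by unfold cycleLabel; grind
    have h2 : cycleLabel (2 * k) (2 * k - 1) + 1 = 2 * k := by unfold cycleLabel; grind
    rw [h1, h2]
    refine Nat.Coprime.mul_right ?_ (by simp)
    rw [Nat.coprime_two_right, Nat.odd_iff]
    omega
  · have h1 : cycleLabel (2 * k + 1) 1 + 1 = k + 1 + 1 := by unfold cycleLabel; grind
    have h2 : cycleLabel (2 * k + 1) (2 * k + 1 - 1) + 1 = k + 1 := by unfold cycleLabel; grind
    rw [h1, h2]
    simp

lemma exists_adj_rotation_of_isCycle {V : Type*} [Fintype V] {G : SimpleGraph V}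
    (hconn : G.Connected) {x : V} {c : G.Walk x x} (hc : c.IsCycle)
    (hlen : c.length < Fintype.card V) :
    ∃ (u w : V) (d : G.Walk u u), d.IsCycle ∧ d.length = c.length ∧ w ∉ d.support ∧
      G.Adj u w := by
  classical
  obtain ⟨z, hz⟩ : ∃ z, z ∉ c.support := by
    by_contra! h
    have h1 : (Finset.univ : Finset V) ⊆ c.support.tail.toFinset := fun z _ ↦
      List.mem_toFinset.mpr <| by
        have := h z
        rw [SimpleGraph.Walk.mem_support_iff] at this
        rcases this with rfl | this
        · exact SimpleGraph.Walk.end_mem_tail_support hc.not_nil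
        · exact this
    have h2 := (Finset.card_le_card h1).trans (List.toFinset_card_le _)
    simp at h2
    omega
  obtain ⟨p⟩ := hconn.preconnected x z
  obtain ⟨d, -, h1, h2⟩ := p.exists_boundary_dart {v | v ∈ c.support} (by simp) hz
  have h1' : d.fst ∈ c.support := h1
  refine ⟨d.fst, d.snd, c.rotate _ h1', hc.rotate h1', ?_, ?_, d.adj⟩
  · simp
  · intro h
    exact h2 (by simpa using h)

lemma Walk.isNeighborhoodPrime_of_isCycle {V : Type*} [Fintype V] {G : SimpleGraph V}
    {u w : V} {c : G.Walk u u} (hc : c.IsCycle) (hlen : Fintype.card V = c.length + 1)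
    (h4 : c.length % 4 ≠ 2) (hw : w ∉ c.support) (huw : G.Adj u w) :
    G.IsNeighborhoodPrime := by
  classical
  have hm := hc.three_le_length
  set m := c.length with hmdef
  let e : Fin (Fintype.card V) → V := fun i ↦ if (i : ℕ) = m then w else c.getVert i
  let l : Fin (Fintype.card V) → Fin (Fintype.card V) := fun i ↦
    ⟨cycleLabel m i, by have hi := i.2; have := cycleLabel_lt (m := m) (i := i) (by omega); omega⟩
  have he : Function.Injective e := by
    intro i j hij
    have hwc (k : ℕ) : c.getVert k ≠ w := fun h ↦ hw (h ▸ c.getVert_mem_support k)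
    have hi := i.2
    have hj := j.2
    ext
    simp only [e] at hij
    split_ifs at hij with h1 h2 h2
    · omega
    · exact (hwc _ hij.symm).elim
    · exact (hwc _ hij).elim
    · exact hc.getVert_injOn' (by simp; omega) (by simp; omega) hij
  have hl : Function.Injective l := fun i j hij ↦
    Fin.ext (cycleLabel_injOn (hlen ▸ i.2) (hlen ▸ j.2) (congrArg Fin.val hij))
  let E := Equiv.ofBijective e ((Fintype.bijective_iff_injective_and_card e).2 ⟨he, by simp⟩)
  let L := Equiv.ofBijective l (Finite.injective_iff_bijective.1 hl)
  let f := E.symm.trans L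
  have hfe (i : Fin (Fintype.card V)) : (f (e i) : ℕ) = cycleLabel m i := by
    have : E.symm (e i) = i := E.symm_apply_apply i
    simp [f, this, L, l]
  have hfc {i : ℕ} (hi : i < m) : (f (c.getVert i) : ℕ) = cycleLabel m i := by
    have := hfe ⟨i, by omega⟩
    simpa [e, hi.ne] using this
  have hfu : (f u : ℕ) = 0 := by
    have := hfc (i := 0) (by omega)
    simpa [cycleLabel_zero] using this
  have hadj_u {v : V} (h : G.Adj v u) :
      (G.neighborFinset v).gcd (fun y ↦ (f y : ℕ) + 1) = 1 := by
    have := Finset.gcd_dvd (f := fun y ↦ (f y : ℕ) + 1) ((G.mem_neighborFinset v u).2 h)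
    simpa [hfu] using this
  have hadj_two {v y z : V} (hy : G.Adj v y) (hz : G.Adj v z)
      (hyz : Nat.Coprime ((f y : ℕ) + 1) ((f z : ℕ) + 1)) :
      (G.neighborFinset v).gcd (fun y ↦ (f y : ℕ) + 1) = 1 :=
    Nat.eq_one_of_dvd_coprimes hyz
      (Finset.gcd_dvd (f := fun y ↦ (f y : ℕ) + 1) ((G.mem_neighborFinset v y).2 hy))
      (Finset.gcd_dvd (f := fun y ↦ (f y : ℕ) + 1) ((G.mem_neighborFinset v z).2 hz))
  have hcm : c.getVert m = u := c.getVert_length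
  refine ⟨f, fun v _ ↦ ?_⟩
  have hv : v = w ∨ ∃ k < m, c.getVert k = v := by
    obtain ⟨i, hi⟩ := E.surjective v
    have hi' : (if (i : ℕ) = m then w else c.getVert i) = v := hi
    split_ifs at hi' with him
    · exact Or.inl hi'.symm
    · exact Or.inr ⟨i, by omega, hi'⟩
  obtain rfl | ⟨k, hk, rfl⟩ := hv
  · exact hadj_u huw.symm
  have hnext := c.adj_getVert_succ hk
  rcases Nat.eq_zero_or_pos k with rfl | hk0
  · have hprev := c.adj_getVert_succ (i := m - 1) (by omega)
    rw [Nat.sub_add_cancel (by omega), hcm] at hprev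
    rw [c.getVert_zero] at hnext ⊢
    refine hadj_two hnext hprev.symm ?_
    rw [hfc (by omega), hfc (by omega)]
    exact coprime_cycleLabel_one hm h4
  · obtain ⟨j, rfl⟩ := Nat.exists_eq_add_of_le' hk0
    rcases (Nat.succ_le_of_lt hk).eq_or_lt with h | h
    · apply hadj_u
      have h' : j + 1 + 1 = m := h
      rwa [h', hcm] at hnext
    · have hprev := c.adj_getVert_succ (i := j) (by omega)
      refine hadj_two hprev.symm hnext ?_
      rw [hfc (by omega), hfc (by omega), cycleLabel_add_two (by omega)]
      simp

end SimpleGraph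

/-- Every connected simple graph of order n with n not congruent to 3 modulo 4
whose circumference equals n − 1 is neighborhood-prime.  (The circumference is the length of
a longest cycle: here we require that there is a cycle of length n − 1 and no longer cycle.) -/
theorem circumference_isNeighborhoodPrime {V : Type*} [Fintype V] (G : SimpleGraph V)
    (hconn : G.Connected)
    (hn : Fintype.card V % 4 ≠ 3)
    (hcyc : ∃ (x : V) (c : G.Walk x x), c.IsCycle ∧ c.length = Fintype.card V - 1)
    (hmax : ∀ (x : V) (c : G.Walk x x), c.IsCycle → c.length ≤ Fintype.card V - 1) :
    G.IsNeighborhoodPrime := by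
  obtain ⟨x, c, hc, hlen⟩ := hcyc
  have h3 := hc.three_le_length
  obtain ⟨u, w, d, hd, hdlen, hw, huw⟩ :=
    SimpleGraph.exists_adj_rotation_of_isCycle hconn hc (by omega)
  exact SimpleGraph.Walk.isNeighborhoodPrime_of_isCycle hd (by omega) (by omega) hw huw
end

section
/- For all integers n ≥ 3 and all integers k with 1 ≤ k ≤ n/2, the generalized Petersen graph GP(n,k) is neighborhood-prime. -/
namespace SimpleGraph

/-- The generalized Petersen graph `GP(n, k)`: outer vertices `.inl i` form an `n`-cycle
(`u_i ~ u_{i+1}`), each outer vertex is joined to the corresponding inner vertex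
(`u_i ~ v_i`), and inner vertices satisfy `v_i ~ v_{i+k}`, indices mod `n`. -/
def genPetersen (n k : ℕ) : SimpleGraph (Fin n ⊕ Fin n) :=
  SimpleGraph.fromRel (fun a b =>
    match a, b with
    | .inl i, .inl j => (j : ℕ) = ((i : ℕ) + 1) % n
    | .inl i, .inr j => i = j
    | .inr i, .inr j => (j : ℕ) = ((i : ℕ) + k) % n
    | _, _ => False)

end SimpleGraph

namespace SimpleGraph

/-- A labeling criterion for `GP(n, k)`, with the vertices indexed by `ZMod n`. -/
theorem genPetersen_isNeighborhoodPrime_of_labels {n k : ℕ} (hn : 3 ≤ n) (hk1 : 1 ≤ k)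
    (hk2 : 2 * k ≤ n) (U V : ZMod n → ℕ) (hU : Function.Injective U)
    (hV : Function.Injective V) (hUV : ∀ i j, U i ≠ V j)
    (hUr : ∀ i, 1 ≤ U i ∧ U i ≤ 2 * n) (hVr : ∀ i, 1 ≤ V i ∧ V i ≤ 2 * n)
    (hUc : ∀ i D, D ∣ U i → D ∣ U (i + 2) → D ∣ V (i + 1) → D = 1)
    (hVc : ∀ i D, D ∣ V i → D ∣ V (i + 2 * k) → D ∣ U (i + k) → D = 1) :
    (genPetersen n k).IsNeighborhoodPrime := by
  classical
  have hinj : ∀ i j : Fin n, ((i : ℕ) : ZMod n) = ((j : ℕ) : ZMod n) → i = j := by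
    intro i j h
    rw [ZMod.natCast_eq_natCast_iff', Nat.mod_eq_of_lt i.2, Nat.mod_eq_of_lt j.2] at h
    exact Fin.ext h
  let L : Fin n ⊕ Fin n → ℕ := Sum.elim (fun i => U (i : ℕ)) (fun i => V (i : ℕ))
  have hL : Function.Injective L := by
    rintro (i | i) (j | j) h
    · exact congrArg _ (hinj _ _ (hU h))
    · exact absurd h (hUV _ _)
    · exact absurd h.symm (hUV _ _)
    · exact congrArg _ (hinj _ _ (hV h))
  have hLr : ∀ x, 1 ≤ L x ∧ L x ≤ 2 * n := by
    rintro (i | i)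
    · exact hUr _
    · exact hVr _
  have hcard : Fintype.card (Fin n ⊕ Fin n) = 2 * n := by simp; ring
  let f : Fin n ⊕ Fin n → Fin (Fintype.card (Fin n ⊕ Fin n)) :=
    fun x => ⟨L x - 1, by have := hLr x; omega⟩
  have hf : Function.Bijective f := by
    rw [Fintype.bijective_iff_injective_and_card]
    refine ⟨fun x y h => hL ?_, by simp⟩
    have h' : L x - 1 = L y - 1 := congrArg Fin.val h
    have := hLr x
    have := hLr y
    omega
  refine ⟨Equiv.ofBijective f hf, fun v _ => ?_⟩
  have hval : ∀ u, ((Equiv.ofBijective f hf u : Fin _) : ℕ) + 1 = L u := fun u => by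
    have := hLr u
    simp only [Equiv.ofBijective_apply, f]
    omega
  simp only [hval]
  have key : ∀ w, (genPetersen n k).Adj v w →
      ((genPetersen n k).neighborFinset v).gcd L ∣ L w := fun w hw =>
    Finset.gcd_dvd (by simpa using hw)
  generalize ((genPetersen n k).neighborFinset v).gcd L = D at key
  have hpred : ∀ i s : ℕ, i < n → s ≤ n → i = ((i + n - s) % n + s) % n := by
    intro i s hi hs
    rw [Nat.mod_add_mod, Nat.sub_add_cancel (by omega), Nat.add_mod_right, Nat.mod_eq_of_lt hi]
  have hne : ∀ i s : ℕ, i < n → 0 < s → s < n → i ≠ (i + s) % n := by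
    intro i s hi hs hs' h
    rcases lt_or_ge (i + s) n with h1 | h1
    · rw [Nat.mod_eq_of_lt h1] at h; omega
    · rw [Nat.mod_eq_sub_mod h1, Nat.mod_eq_of_lt (by omega)] at h; omega
  have hcast : ∀ i s : ℕ, s ≤ n → (((i + n - s) % n : ℕ) : ZMod n) = (i : ZMod n) - s := by
    intro i s hs
    rw [ZMod.natCast_mod, Nat.cast_sub (by omega)]
    simp
  have hn0 : 0 < n := by omega
  rcases v with i | i
  · have h1 := key (.inl ⟨(i + 1) % n, Nat.mod_lt _ hn0⟩) (by
      simp only [genPetersen, fromRel_adj]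
      refine ⟨fun h => hne i 1 i.2 (by omega) (by omega) ?_, by simp⟩
      exact congrArg Fin.val (Sum.inl.inj h))
    have h2 := key (.inl ⟨(i + n - 1) % n, Nat.mod_lt _ hn0⟩) (by
      have hp := hpred i 1 i.2 (by omega)
      simp only [genPetersen, fromRel_adj]
      refine ⟨fun h => hne ((i + n - 1) % n) 1 (Nat.mod_lt _ hn0) (by omega) (by omega) ?_,
        Or.inr hp⟩
      rw [← hp]
      exact (congrArg Fin.val (Sum.inl.inj h)).symm)
    have h3 := key (.inr i) (by simp [genPetersen, fromRel_adj])
    simp only [L, Sum.elim_inl, Sum.elim_inr] at h1 h2 h3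
    rw [hcast _ _ (by omega)] at h2
    refine hUc ((i : ℕ) - 1) D (by simpa using h2) ?_ (by simpa using h3)
    rw [ZMod.natCast_mod] at h1
    convert h1 using 2
    push_cast
    ring
  · have h1 := key (.inr ⟨(i + k) % n, Nat.mod_lt _ hn0⟩) (by
      simp only [genPetersen, fromRel_adj]
      refine ⟨fun h => hne i k i.2 (by omega) (by omega) ?_, by simp⟩
      exact congrArg Fin.val (Sum.inr.inj h))
    have h2 := key (.inr ⟨(i + n - k) % n, Nat.mod_lt _ hn0⟩) (by
      have hp := hpred i k i.2 (by omega)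
      simp only [genPetersen, fromRel_adj]
      refine ⟨fun h => hne ((i + n - k) % n) k (Nat.mod_lt _ hn0) (by omega) (by omega) ?_,
        Or.inr hp⟩
      rw [← hp]
      exact (congrArg Fin.val (Sum.inr.inj h)).symm)
    have h3 := key (.inl i) (by simp [genPetersen, fromRel_adj])
    simp only [L, Sum.elim_inl, Sum.elim_inr] at h1 h2 h3
    rw [hcast _ _ (by omega)] at h2
    refine hVc ((i : ℕ) - k) D h2 ?_ (by simpa using h3)
    rw [ZMod.natCast_mod] at h1
    convert h1 using 2
    push_cast
    ring

end SimpleGraph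

/-- Reduction modulo `gcd (e * m) s = e` separates the cosets of the subgroup generated by `s`. -/
theorem Nat.ModEq.base_of_add_mul_step {e m s b b' q q' : ℕ} (he : Nat.gcd (e * m) s = e)
    (h : b + s * q ≡ b' + s * q' [MOD e * m]) : b ≡ b' [MOD e] := by
  have hs : e ∣ s := he ▸ Nat.gcd_dvd_right (e * m) s
  have hz : ∀ x, s * x ≡ 0 [MOD e] := fun x =>
    (Nat.modEq_zero_iff_dvd).2 (hs.mul_right x)
  have h' : b + s * q ≡ b' + s * q' [MOD e] := h.of_mul_right m
  simpa using ((Nat.ModEq.add_left b (hz q)).symm.trans h').trans (Nat.ModEq.add_left b' (hz q'))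

theorem Nat.ModEq.eq_of_add_mul_step {e m s b q q' : ℕ} (hpos : 0 < e * m)
    (he : Nat.gcd (e * m) s = e) (hq : q < m) (hq' : q' < m)
    (h : b + s * q ≡ b + s * q' [MOD e * m]) : q = q' := by
  have h1 := (Nat.ModEq.add_left_cancel' b h).cancel_left_div_gcd hpos
  rw [he, Nat.mul_div_cancel_left _ (Nat.pos_of_mul_pos_right hpos)] at h1
  exact h1.eq_of_lt_of_lt hq hq'

/-- Arithmetic progressions with difference `s`, one for each class modulo `gcd n s`,
enumerate `ZMod n`. -/
theorem ZMod.bijective_base_add_mul_step {ι : Type*} [Fintype ι] {n e m s : ℕ} (hn : n = e * m)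
    (hpos : 0 < n) (he : Nat.gcd n s = e) (hι : Fintype.card ι = e) (b : ι → ℕ)
    (hb : ∀ c c', b c ≡ b c' [MOD e] → c = c') :
    Function.Bijective (fun p : ι × Fin m => ((b p.1 + s * p.2 : ℕ) : ZMod n)) := by
  subst hn
  have : NeZero (e * m) := ⟨hpos.ne'⟩
  rw [Fintype.bijective_iff_injective_and_card]
  refine ⟨?_, by simp [hι, ZMod.card]⟩
  rintro ⟨c, q⟩ ⟨c', q'⟩ h
  have h' := (ZMod.natCast_eq_natCast_iff _ _ _).1 h
  obtain rfl := hb c c' (Nat.ModEq.base_of_add_mul_step he h')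
  exact Prod.ext rfl (Fin.ext (Nat.ModEq.eq_of_add_mul_step hpos he q.2 q'.2 h'))

/-- Gluing lemma. The pairs of outer vertices at distance two along the rim form `d` cycles of
length `h`, labeled by `P`; the pairs of inner vertices at distance two form `d * e` cycles of
length `m`, labeled by consecutive numbers starting at `a`. -/
theorem SimpleGraph.genPetersen_isNeighborhoodPrime_of_blocks {n k d h e m : ℕ} (hn : 3 ≤ n)
    (hk1 : 1 ≤ k) (hk2 : 2 * k ≤ n) (hdh : n = d * h) (hd : Nat.gcd n 2 = d) (hem : h = e * m)
    (he : Nat.gcd n (2 * k) = d * e) (P a : ℕ → ℕ → ℕ)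
    (hP : ∀ ε j ε' j', ε < d → j < h → ε' < d → j' < h → P ε j = P ε' j' → ε = ε' ∧ j = j')
    (ha : ∀ ε c q ε' c' q', ε < d → c < e → q < m → ε' < d → c' < e → q' < m →
      a ε c + q = a ε' c' + q' → ε = ε' ∧ c = c' ∧ q = q')
    (hPa : ∀ ε j ε' c q, ε < d → j < h → ε' < d → c < e → q < m → P ε j ≠ a ε' c + q)
    (hPr : ∀ ε j, ε < d → j < h → 1 ≤ P ε j ∧ P ε j ≤ 2 * n)
    (har : ∀ ε c, ε < d → c < e → 1 ≤ a ε c ∧ a ε c + (m - 1) ≤ 2 * n)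
    (hstep : ∀ ε j, ε < d → j + 1 < h → Nat.Coprime (P ε j) (P ε (j + 1)))
    (hclose : ∀ ε, ε < d → Nat.Coprime (P ε (h - 1)) (P ε 0))
    (hspoke : ∀ ε c, ε < d → c < e → ∃ t, t < m ∧
      ∀ D, D ∣ P ε (c + t * e) → D ∣ a ε c → D ∣ m - 1 → D = 1) :
    (genPetersen n k).IsNeighborhoodPrime := by
  have hn0 : 0 < n := by omega
  have hd2 : d ∣ 2 := hd ▸ Nat.gcd_dvd_right n 2
  have hde : d * e ∣ 2 * k := he ▸ Nat.gcd_dvd_right n (2 * k)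
  have hnde : n = d * e * m := by rw [hdh, hem, mul_assoc]
  have hde0 : 0 < d * e := Nat.pos_of_mul_pos_right (hnde ▸ hn0)
  have hh0 : 0 < h := Nat.pos_of_mul_pos_left (hdh ▸ hn0)
  have hm0 : 0 < m := Nat.pos_of_mul_pos_left (hnde ▸ hn0)
  have hgcd : Nat.gcd (d * e) 2 = d := by
    apply Nat.dvd_antisymm
    · rw [← hd]
      exact Nat.gcd_dvd_gcd_of_dvd_left 2 (hd.symm ▸ ⟨m, hnde⟩)
    · exact Nat.dvd_gcd (Dvd.intro _ rfl) hd2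
  choose! t htm htD using hspoke
  have hpos : ∀ ε c, ε < d → c < e → c + t ε c * e < h := by
    intro ε c hε hc
    have := Nat.mul_le_mul_right e (Nat.succ_le_of_lt (htm ε c hε hc))
    rw [Nat.succ_mul, mul_comm m e, ← hem] at this
    omega
  have bijO := ZMod.bijective_base_add_mul_step (ι := Fin d) hdh hn0 hd (by simp)
    (fun ε => (ε : ℕ)) (fun c c' hc => Fin.ext (hc.eq_of_lt_of_lt c.2 c'.2))
  have bijI := ZMod.bijective_base_add_mul_step (ι := Fin d × Fin e) hnde hn0 he (by simp)
    (fun p => (p.1 + 2 * (p.2 + t p.1 p.2 * e)) + k) (by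
      rintro ⟨ε, c⟩ ⟨ε', c'⟩ hc
      have hc := Nat.ModEq.add_right_cancel' _ hc
      have hred : ∀ x y z : ℕ, x + 2 * (y + z * e) ≡ x + 2 * y [MOD d * e] := by
        intro x y z
        have hz : 2 * (z * e) ≡ 0 [MOD d * e] := by
          rw [Nat.modEq_zero_iff_dvd, show 2 * (z * e) = 2 * e * z by ring]
          exact (Nat.mul_dvd_mul_right hd2 e).mul_right z
        simpa [mul_add, add_assoc] using Nat.ModEq.add_left (x + 2 * y) hz
      have hc' := ((hred _ _ _).symm.trans hc).trans (hred _ _ _)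
      have h1 : ε = ε' := Fin.ext
        ((Nat.ModEq.base_of_add_mul_step hgcd hc').eq_of_lt_of_lt ε.2 ε'.2)
      subst h1
      exact Prod.ext rfl (Fin.ext (Nat.ModEq.eq_of_add_mul_step hde0 hgcd c.2 c'.2 hc')))
  let eO := Equiv.ofBijective _ bijO
  let eI := Equiv.ofBijective _ bijI
  let U : ZMod n → ℕ := fun x => P (eO.symm x).1 (eO.symm x).2
  let V : ZMod n → ℕ := fun x => a (eI.symm x).1.1 (eI.symm x).1.2 + (eI.symm x).2
  have hUeq : ∀ ε j, ε < d → j < h → U ((ε + 2 * j : ℕ) : ZMod n) = P ε j := by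
    intro ε j hε hj
    have : eO.symm ((ε + 2 * j : ℕ) : ZMod n) = (⟨ε, hε⟩, ⟨j, hj⟩) := by
      rw [Equiv.symm_apply_eq]; rfl
    simp only [U, this]
  have hVeq : ∀ ε c q, ε < d → c < e → q < m →
      V (((ε + 2 * (c + t ε c * e)) + k + 2 * k * q : ℕ) : ZMod n) = a ε c + q := by
    intro ε c q hε hc hq
    have : eI.symm (((ε + 2 * (c + t ε c * e)) + k + 2 * k * q : ℕ) : ZMod n) =
        ((⟨ε, hε⟩, ⟨c, hc⟩), ⟨q, hq⟩) := by
      rw [Equiv.symm_apply_eq]; rfl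
    simp only [V, this]
  have hcast0 : ∀ x : ℕ, n ∣ x → (x : ZMod n) = 0 := fun x hx =>
    (ZMod.natCast_eq_zero_iff x n).2 hx
  have h2h : ((2 * h : ℕ) : ZMod n) = 0 := hcast0 _ (hdh ▸ Nat.mul_dvd_mul_right hd2 h)
  have h2km : ((2 * k * m : ℕ) : ZMod n) = 0 := hcast0 _ (hnde ▸ Nat.mul_dvd_mul_right hde m)
  refine genPetersen_isNeighborhoodPrime_of_labels hn hk1 hk2 U V ?_ ?_ ?_ ?_ ?_ ?_ ?_
  · intro x y hxy
    have h1 := hP _ _ _ _ (eO.symm x).1.2 (eO.symm x).2.2 (eO.symm y).1.2 (eO.symm y).2.2 hxy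
    exact eO.symm.injective (Prod.ext (Fin.ext h1.1) (Fin.ext h1.2))
  · intro x y hxy
    have h1 := ha _ _ _ _ _ _ (eI.symm x).1.1.2 (eI.symm x).1.2.2 (eI.symm x).2.2
      (eI.symm y).1.1.2 (eI.symm y).1.2.2 (eI.symm y).2.2 hxy
    exact eI.symm.injective
      (Prod.ext (Prod.ext (Fin.ext h1.1) (Fin.ext h1.2.1)) (Fin.ext h1.2.2))
  · exact fun x y => hPa _ _ _ _ _ (eO.symm x).1.2 (eO.symm x).2.2 (eI.symm y).1.1.2
      (eI.symm y).1.2.2 (eI.symm y).2.2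
  · exact fun x => hPr _ _ (eO.symm x).1.2 (eO.symm x).2.2
  · intro x
    have h1 := har _ _ (eI.symm x).1.1.2 (eI.symm x).1.2.2
    have h2 := (eI.symm x).2.2
    simp only [V]
    omega
  · intro x D h1 h2 _
    obtain ⟨⟨⟨ε, hε⟩, ⟨j, hj⟩⟩, rfl⟩ := bijO.2 x
    simp only at h1 h2
    rw [hUeq ε j hε hj] at h1
    rcases Nat.lt_or_ge (j + 1) h with hj' | hj'
    · rw [show ((ε + 2 * j : ℕ) : ZMod n) + 2 = ((ε + 2 * (j + 1) : ℕ) : ZMod n) by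
        push_cast; ring, hUeq ε _ hε hj'] at h2
      exact Nat.eq_one_of_dvd_coprimes (hstep ε j hε hj') h1 h2
    · obtain rfl : h = j + 1 := by omega
      rw [show ((ε + 2 * j : ℕ) : ZMod n) + 2 = ((ε + 2 * 0 : ℕ) : ZMod n) by
        push_cast at h2h ⊢; linear_combination h2h, hUeq ε _ hε hh0] at h2
      exact Nat.eq_one_of_dvd_coprimes (hclose ε hε) h1 h2
  · intro x D h1 h2 h3
    obtain ⟨⟨⟨⟨ε, hε⟩, ⟨c, hc⟩⟩, ⟨q, hq⟩⟩, rfl⟩ := bijI.2 x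
    simp only at h1 h2 h3
    rw [hVeq ε c q hε hc hq] at h1
    rcases Nat.lt_or_ge (q + 1) m with hq' | hq'
    · rw [show (((ε + 2 * (c + t ε c * e)) + k + 2 * k * q : ℕ) : ZMod n) + 2 * k =
        (((ε + 2 * (c + t ε c * e)) + k + 2 * k * (q + 1) : ℕ) : ZMod n) by
        push_cast; ring, hVeq ε c _ hε hc hq', ← add_assoc] at h2
      exact Nat.dvd_one.1 ((Nat.dvd_add_right h1).1 h2)
    · obtain rfl : m = q + 1 := by omega
      rw [show (((ε + 2 * (c + t ε c * e)) + k + 2 * k * q : ℕ) : ZMod n) + 2 * k =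
        (((ε + 2 * (c + t ε c * e)) + k + 2 * k * 0 : ℕ) : ZMod n) by
        push_cast at h2km ⊢; linear_combination h2km, hVeq ε c _ hε hc hm0] at h2
      rw [show (((ε + 2 * (c + t ε c * e)) + k + 2 * k * q : ℕ) : ZMod n) + k =
        ((ε + 2 * (c + t ε c * e) : ℕ) : ZMod n) by
        push_cast at h2km ⊢; linear_combination h2km, hUeq ε _ hε (hpos ε c hε hc)] at h3
      exact htD ε c hε hc D h3 h2 ((Nat.dvd_add_right h2).1 h1)

/-- The case `n = 2 * k`: the outer vertex `u_i` and the inner vertex `v_{i+k}` get consecutive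
labels, the outer one odd. -/
theorem SimpleGraph.genPetersen_two_mul_isNeighborhoodPrime {k : ℕ} (hk : 2 ≤ k) :
    (genPetersen (2 * k) k).IsNeighborhoodPrime := by
  have bij := ZMod.bijective_base_add_mul_step (ι := Fin 2) (n := 2 * k) (m := k) (s := 2) rfl
    (by omega) (by simp) (by simp) (fun ε => 3 * ε) (by
      intro c c' h
      have h : (3 * (c : ℕ)) % 2 = (3 * c') % 2 := h
      omega)
  let eO := Equiv.ofBijective _ bij
  let U : ZMod (2 * k) → ℕ := fun x => 2 * ((eO.symm x).1 * k + (eO.symm x).2) + 1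
  have hUeq : ∀ ε j, ε < 2 → j < k →
      U ((3 * ε + 2 * j : ℕ) : ZMod (2 * k)) = 2 * (ε * k + j) + 1 := by
    intro ε j hε hj
    have : eO.symm ((3 * ε + 2 * j : ℕ) : ZMod (2 * k)) = (⟨ε, hε⟩, ⟨j, hj⟩) := by
      rw [Equiv.symm_apply_eq]; rfl
    simp only [U, this]
  have hUr : ∀ x, U x % 2 = 1 ∧ U x + 1 ≤ 2 * (2 * k) := by
    intro x
    obtain ⟨⟨⟨ε, hε⟩, ⟨j, hj⟩⟩, rfl⟩ := bij.2 x
    simp only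
    rw [hUeq ε j hε hj]
    interval_cases ε <;> omega
  have h2k : ((2 * k : ℕ) : ZMod (2 * k)) = 0 := ZMod.natCast_self _
  have hU : Function.Injective U := by
    intro x y hxy
    obtain ⟨⟨⟨ε, hε⟩, ⟨j, hj⟩⟩, rfl⟩ := bij.2 x
    obtain ⟨⟨⟨ε', hε'⟩, ⟨j', hj'⟩⟩, rfl⟩ := bij.2 y
    simp only at hxy ⊢
    rw [hUeq ε j hε hj, hUeq ε' j' hε' hj'] at hxy
    have : ε = ε' ∧ j = j' := by interval_cases ε <;> interval_cases ε' <;> omega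
    rw [this.1, this.2]
  refine genPetersen_isNeighborhoodPrime_of_labels (by omega) (by omega) le_rfl U
    (fun x => U (x + k) + 1) hU ?_ ?_ ?_ ?_ ?_ ?_
  · intro x y hxy
    exact add_right_cancel (hU (Nat.succ_injective hxy))
  · intro i j h
    have := (hUr i).1
    have := (hUr (j + k)).1
    omega
  · intro i
    have := hUr i
    omega
  · intro i
    have := hUr (i + k)
    omega
  · intro x D h1 h2 h3
    obtain ⟨⟨⟨ε, hε⟩, ⟨j, hj⟩⟩, rfl⟩ := bij.2 x
    simp only at h1 h2 h3
    rw [hUeq ε j hε hj] at h1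
    rcases Nat.lt_or_ge (j + 1) k with hj' | hj'
    · rw [show ((3 * ε + 2 * j : ℕ) : ZMod (2 * k)) + 2 =
        ((3 * ε + 2 * (j + 1) : ℕ) : ZMod (2 * k)) by push_cast; ring, hUeq ε _ hε hj',
        show 2 * (ε * k + (j + 1)) + 1 = 2 * (ε * k + j) + 1 + 2 by ring] at h2
      have hD : D ∣ 2 := (Nat.dvd_add_right h1).1 h2
      rcases (Nat.dvd_prime Nat.prime_two).1 hD with rfl | rfl
      · rfl
      · omega
    · obtain rfl : k = j + 1 := by omega
      rw [show ((3 * ε + 2 * j : ℕ) : ZMod (2 * (j + 1))) + 2 =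
        ((3 * ε + 2 * 0 : ℕ) : ZMod (2 * (j + 1))) by
        push_cast at h2k ⊢; linear_combination h2k, hUeq ε _ hε (by omega)] at h2
      rw [show ((3 * ε + 2 * j : ℕ) : ZMod (2 * (j + 1))) + 1 +
          ((j + 1 : ℕ) : ZMod (2 * (j + 1))) =
        ((3 * ε + j : ℕ) : ZMod (2 * (j + 1))) by
        push_cast at h2k ⊢; linear_combination h2k] at h3
      interval_cases ε
      · simpa using h2
      · have hD : D ∣ 3 := by
          rw [show 3 = 2 * (2 * (1 * (j + 1) + 0) + 1) - (2 * (1 * (j + 1) + j) + 1) by omega]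
          exact Nat.dvd_sub (h2.mul_left 2) h1
        rcases (Nat.dvd_prime Nat.prime_three).1 hD with rfl | rfl
        · rfl
        · rcases Nat.even_or_odd' j with ⟨l, rfl | rfl⟩
          · have h4 := hUeq 1 l (by omega) (by omega)
            rw [h4] at h3
            omega
          · have h4 := hUeq 0 (l + 2) (by omega) (by omega)
            rw [show 3 * 1 + (2 * l + 1) = 3 * 0 + 2 * (l + 2) by ring, h4] at h3
            omega
  · intro x D h1 h2 h3
    exact Nat.dvd_one.1 ((Nat.dvd_add_right h3).1 h1)

/-- An arithmetic progression meets the units modulo `g` unless a prime obstructs it. -/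
theorem Nat.exists_coprime_add_mul {c e g : ℕ} (hg : 0 < g)
    (h : ∀ p, p.Prime → p ∣ c → p ∣ e → ¬ p ∣ g) :
    ∃ t, 1 ≤ t ∧ t ≤ g ∧ Nat.Coprime (c + t * e) g := by
  let t₀ := ∏ p ∈ g.primeFactors.filter (fun p => ¬ p ∣ c), p
  have ht₀ : Nat.Coprime (c + t₀ * e) g := by
    refine Nat.Coprime.symm (Nat.coprime_of_dvd fun p hp hpg hpt => ?_)
    by_cases hpc : p ∣ c
    · rcases hp.dvd_mul.1 ((Nat.dvd_add_right hpc).1 hpt) with h1 | h1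
      · obtain ⟨r, hr, hpr⟩ := (hp.prime.dvd_finsetProd_iff _).1 h1
        simp only [Finset.mem_filter, Nat.mem_primeFactors] at hr
        exact hr.2 ((Nat.prime_dvd_prime_iff_eq hp hr.1.1).1 hpr ▸ hpc)
      · exact h p hp hpc h1 hpg
    · have h1 : p ∣ t₀ := Finset.dvd_prod_of_mem (fun p => p) (by simp [hp, hpg, hg.ne', hpc])
      exact hpc ((Nat.dvd_add_left (h1.mul_right e)).1 hpt)
  have hmod : ∀ t, t ≡ t₀ [MOD g] → Nat.Coprime (c + t * e) g := by
    intro t ht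
    rw [Nat.Coprime, Nat.ModEq.gcd_eq (Nat.ModEq.add_left c (ht.mul_right e))]
    exact ht₀
  rcases Nat.eq_zero_or_pos (t₀ % g) with h0 | h0
  · exact ⟨g, hg, le_rfl, hmod g (by rw [Nat.ModEq, h0, Nat.mod_self])⟩
  · exact ⟨t₀ % g, h0, (Nat.mod_lt _ hg).le, hmod _ (Nat.mod_modEq _ _)⟩

/-- Among the outer labels `ε * h + j` with `j` in a fixed class modulo `e`, one is coprime to the
two ends of the inner block of length `m` assigned to that class. -/
theorem Nat.exists_spoke {e m c ε d : ℕ} (hm : 2 ≤ m) :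
    ∃ t, 1 ≤ t ∧ t < m ∧ ∀ D, D ∣ ε * (e * m) + (c + t * e) →
      D ∣ d * (e * m) + 1 + (c + ε * e) * m → D ∣ m - 1 → D = 1 := by
  have hg : 0 < Nat.gcd (d * (e * m) + 1 + (c + ε * e) * m) (m - 1) :=
    Nat.gcd_pos_of_pos_right _ (by omega)
  obtain ⟨t, ht1, htg, ht⟩ := Nat.exists_coprime_add_mul (c := ε * (e * m) + c) (e := e) hg (by
    intro p hp hpc hpe hpg
    have hpc : p ∣ c := (Nat.dvd_add_right ((hpe.mul_right m).mul_left ε)).1 hpc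
    have hpa := hpg.trans (Nat.gcd_dvd_left _ _)
    rw [show d * (e * m) + 1 + (c + ε * e) * m = (e * (d * m + ε * m) + c * m) + 1 by ring] at hpa
    exact hp.one_lt.ne' (Nat.dvd_one.1
      ((Nat.dvd_add_right (dvd_add (hpe.mul_right _) (hpc.mul_right _))).1 hpa)))
  have hgm := Nat.le_of_dvd (by omega)
    (Nat.gcd_dvd_right (d * (e * m) + 1 + (c + ε * e) * m) (m - 1))
  refine ⟨t, ht1, by omega, fun D h1 h2 h3 => ?_⟩
  rw [← add_assoc] at h1
  exact Nat.eq_one_of_dvd_coprimes ht h1 (Nat.dvd_gcd h2 h3)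

theorem Nat.mul_add_unique {m r q r' q' : ℕ} (hq : q < m) (hq' : q' < m)
    (h : r * m + q = r' * m + q') : r = r' ∧ q = q' := by
  have hm : 0 < m := by omega
  have h1 : (r * m + q) / m = r := by
    rw [Nat.add_comm, Nat.add_mul_div_right _ _ hm, Nat.div_eq_of_lt hq, zero_add]
  have h2 : (r' * m + q') / m = r' := by
    rw [Nat.add_comm, Nat.add_mul_div_right _ _ hm, Nat.div_eq_of_lt hq', zero_add]
  have h3 : r = r' := by rw [← h1, ← h2, h]
  subst h3
  exact ⟨rfl, by omega⟩

theorem Nat.add_mul_add_one_le {c e ε d : ℕ} (hε : ε < d) (hc : c < e) :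
    c + ε * e + 1 ≤ d * e := by
  have := Nat.mul_le_mul_right e (Nat.succ_le_of_lt hε)
  rw [Nat.succ_mul] at this
  omega

/-- If `n` is odd or divisible by four, the outer vertices can take the labels `1, …, n` in
consecutive runs. -/
theorem SimpleGraph.genPetersen_isNeighborhoodPrime_of_rim_even {n k d h e m : ℕ} (hn : 3 ≤ n)
    (hk1 : 1 ≤ k) (hk2 : 2 * k ≤ n) (hdh : n = d * h) (hd : Nat.gcd n 2 = d) (hem : h = e * m)
    (he : Nat.gcd n (2 * k) = d * e) (hm : 2 ≤ m) (hh : d = 2 → Even h) :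
    (genPetersen n k).IsNeighborhoodPrime := by
  have hd2 : d ≤ 2 := Nat.le_of_dvd (by omega) (hd ▸ Nat.gcd_dvd_right n 2)
  have he0 : 0 < e := by
    rcases Nat.eq_zero_or_pos e with rfl | h0
    · simp [hem] at hdh; omega
    · exact h0
  have hh2 : 2 ≤ h := hem ▸ hm.trans (Nat.le_mul_of_pos_left m he0)
  have hrim : ∀ ε j, ε < d → j < h → ε * h + j + 1 ≤ n := by
    intro ε j hε hj
    have := Nat.add_mul_add_one_le hε hj
    rw [hdh]
    omega
  refine genPetersen_isNeighborhoodPrime_of_blocks hn hk1 hk2 hdh hd hem he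
    (fun ε j => ε * h + (if j = 0 then h else j)) (fun ε c => n + 1 + (c + ε * e) * m)
    ?_ ?_ ?_ ?_ ?_ ?_ ?_ ?_
  · intro ε j ε' j' hε hj hε' hj' heq
    have := Nat.mul_add_unique (m := h) (r := ε) (q := (if j = 0 then h else j) - 1)
      (r' := ε') (q' := (if j' = 0 then h else j') - 1) (by split_ifs <;> omega)
      (by split_ifs <;> omega) (by split_ifs at heq ⊢ <;> omega)
    refine ⟨this.1, ?_⟩
    have := this.2
    split_ifs at this <;> omega
  · intro ε c q ε' c' q' hε hc hq hε' hc' hq' heq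
    have h1 := Nat.mul_add_unique (r := c + ε * e) (r' := c' + ε' * e) hq hq' (by omega)
    have h2 := Nat.mul_add_unique (r := ε) (r' := ε') hc hc' (by omega)
    exact ⟨h2.1, h2.2, h1.2⟩
  · intro ε j ε' c q hε hj _ _ _ heq
    have := hrim ε j hε hj
    have := hrim ε (h - 1) hε (by omega)
    split_ifs at heq <;> omega
  · intro ε j hε hj
    have := hrim ε j hε hj
    have := hrim ε (h - 1) hε (by omega)
    split_ifs <;> omega
  · intro ε c hε hc
    have := Nat.mul_le_mul_right m (Nat.add_mul_add_one_le hε hc)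
    rw [Nat.succ_mul, mul_assoc, ← hem, ← hdh] at this
    omega
  · intro ε j hε hj
    rcases Nat.eq_zero_or_pos j with rfl | hj0
    · obtain rfl | ⟨rfl, rfl⟩ : ε = 0 ∨ (ε = 1 ∧ d = 2) := by omega
      · simp
      · obtain ⟨l, rfl⟩ := hh rfl
        rw [if_pos rfl, if_neg (by omega),
          show 1 * (l + l) + (l + l) = 2 * (l + l) by ring, one_mul]
        refine Nat.Coprime.mul_left ?_ (by simp)
        exact Nat.coprime_two_left.2 ⟨l, by ring⟩
    · rw [if_neg (by omega), if_neg (by omega), ← add_assoc]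
      simp
  · intro ε hε
    rw [if_neg (by omega), if_pos rfl]
    obtain ⟨l, rfl⟩ : ∃ l, h = l + 1 := ⟨h - 1, by omega⟩
    rw [Nat.add_sub_cancel, ← add_assoc]
    simp
  · intro ε c hε hc
    obtain ⟨t, ht1, htm, ht⟩ := Nat.exists_spoke (e := e) (c := c) (ε := ε) (d := d) hm
    refine ⟨t, htm, fun D h1 h2 h3 => ht D ?_ ?_ h3⟩
    · have : 0 < t * e := Nat.mul_pos ht1 he0
      rwa [if_neg (by omega), hem] at h1
    · rwa [hdh, hem] at h2

/-- If `n = 2 * h` with `h` odd, the outer runs are `1, 2 * h + m, 2, …, h - 1` and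
`h, …, 2 * h - 1`, and the remaining labels go to the inner vertices. -/
theorem SimpleGraph.genPetersen_isNeighborhoodPrime_of_rim_odd {n k h e m : ℕ} (hn : 3 ≤ n)
    (hk1 : 1 ≤ k) (hk2 : 2 * k ≤ n) (hdh : n = 2 * h) (hem : h = e * m)
    (he : Nat.gcd n (2 * k) = 2 * e) (hm : 2 ≤ m) (hh : Odd h) :
    (genPetersen n k).IsNeighborhoodPrime := by
  have hmo : Odd m := (Nat.odd_mul.1 (hem ▸ hh)).2
  have he0 : 0 < e := by
    rcases Nat.eq_zero_or_pos e with rfl | h0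
    · simp [hem] at hh
    · exact h0
  have hmh : m ≤ h := hem ▸ Nat.le_mul_of_pos_left m he0
  have hm3 : 3 ≤ m := by obtain ⟨l, rfl⟩ := hmo; omega
  have hblock : ∀ ε c, ¬ (ε = 0 ∧ c = 0) → m ≤ (c + ε * e) * m := by
    intro ε c h0
    refine Nat.le_mul_of_pos_left m ?_
    rcases Nat.eq_zero_or_pos ε with rfl | hε
    · omega
    · have := Nat.mul_pos hε he0
      omega
  refine genPetersen_isNeighborhoodPrime_of_blocks hn hk1 hk2 hdh
    (by rw [hdh]; simp) hem he
    (fun ε j => if ε = 1 then h + j else if j = 0 then 1 else if j = 1 then 2 * h + m else j)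
    (fun ε c => if ε = 0 ∧ c = 0 then 2 * h else 2 * h + 1 + (c + ε * e) * m)
    ?_ ?_ ?_ ?_ ?_ ?_ ?_ ?_
  · intro ε j ε' j' hε hj hε' hj' heq
    split_ifs at heq <;> omega
  · intro ε c q ε' c' q' hε hc hq hε' hc' hq' heq
    have h1 := hblock ε c
    have h1' := hblock ε' c'
    split_ifs at heq with h2 h2' h2'
    · omega
    · have := h1' h2'
      omega
    · have := h1 h2
      omega
    · have h3 := Nat.mul_add_unique (r := c + ε * e) (r' := c' + ε' * e) hq hq' (by omega)
      have h4 := Nat.mul_add_unique (r := ε) (r' := ε') hc hc' (by omega)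
      exact ⟨h4.1, h4.2, h3.2⟩
  · intro ε j ε' c q hε hj _ _ hq heq
    have h1 := hblock ε' c
    split_ifs at heq <;> omega
  · intro ε j hε hj
    split_ifs <;> omega
  · intro ε c hε hc
    have := Nat.mul_le_mul_right m (Nat.add_mul_add_one_le hε hc)
    rw [Nat.succ_mul, mul_assoc, ← hem, ← hdh] at this
    split_ifs <;> omega
  · intro ε j hε hj
    obtain rfl | rfl : ε = 0 ∨ ε = 1 := by omega
    · rcases j with _ | _ | j
      · simp
      · have : Odd (2 * h + m) := (even_two_mul h).add_odd hmo
        simpa using this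
      · simp
    · simp [← add_assoc]
  · intro ε hε
    obtain rfl | rfl : ε = 0 ∨ ε = 1 := by omega
    · simp
    · obtain ⟨l, rfl⟩ : ∃ l, h = l + 1 := ⟨h - 1, by omega⟩
      rw [if_pos rfl, if_pos rfl, Nat.add_sub_cancel, add_zero]
      simp
  · intro ε c hε hc
    by_cases h0 : ε = 0 ∧ c = 0
    · obtain ⟨rfl, rfl⟩ := h0
      exact ⟨0, by omega, fun D h1 _ _ => by simpa using h1⟩
    · obtain ⟨t, ht1, htm, ht⟩ := Nat.exists_spoke (e := e) (c := c) (ε := ε) (d := 2) hm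
      refine ⟨t, htm, fun D h1 h2 h3 => ht D ?_ ?_ h3⟩
      · have : 0 < t * e := Nat.mul_pos ht1 he0
        have : c < t * e := hc.trans_le (Nat.le_mul_of_pos_left e ht1)
        obtain rfl | rfl : ε = 0 ∨ ε = 1 := by omega
        · rw [if_neg (by omega), if_neg (by omega), if_neg (by omega)] at h1
          simpa using h1
        · rw [if_pos rfl, hem] at h1
          simpa using h1
      · rwa [if_neg h0, hem] at h2

/-- For all integers n ≥ 3 and all integers k with 1 ≤ k ≤ n/2, the
generalized Petersen graph GP(n,k) is neighborhood-prime. -/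
theorem genPetersen_isNeighborhoodPrime (n k : ℕ) (hn : 3 ≤ n) (hk1 : 1 ≤ k)
    (hk2 : k ≤ n / 2) :
    (SimpleGraph.genPetersen n k).IsNeighborhoodPrime := by
  rcases eq_or_ne n (2 * k) with rfl | hne
  · exact SimpleGraph.genPetersen_two_mul_isNeighborhoodPrime (by omega)
  obtain ⟨h, hdh⟩ := Nat.gcd_dvd_left n 2
  obtain ⟨e, he⟩ := Nat.gcd_dvd_gcd_mul_right_right n 2 k
  obtain ⟨m, hm⟩ := Nat.gcd_dvd_left n (2 * k)
  have hd0 : 0 < Nat.gcd n 2 := Nat.gcd_pos_of_pos_right _ (by omega)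
  have hem : h = e * m := by
    apply Nat.eq_of_mul_eq_mul_left hd0
    rw [← hdh, ← mul_assoc, ← he, ← hm]
  have hm2 : 2 ≤ m := by
    by_contra hlt
    obtain rfl | rfl : m = 0 ∨ m = 1 := by omega
    · omega
    · have hdvd : n ∣ 2 * k := Nat.gcd_eq_left_iff_dvd.1 (by omega)
      have := Nat.le_of_dvd (by omega) hdvd
      omega
  by_cases hh : Nat.gcd n 2 = 2 → Even h
  · exact SimpleGraph.genPetersen_isNeighborhoodPrime_of_rim_even hn hk1 (by omega) hdh rfl hem he
      hm2 hh
  · push Not at hh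
    rw [hh.1] at hdh he
    exact SimpleGraph.genPetersen_isNeighborhoodPrime_of_rim_odd hn hk1 (by omega) hdh hem he hm2
      (Nat.not_even_iff_odd.1 hh.2)
end

section
/- For every integer n ≥ 8 with n ≡ 0 (mod 4), the generalized Petersen graph GP(n, n/2) is neighborhood-prime. -/
namespace SimpleGraph

open scoped Classical in
/-- Exhibiting an injective labeling by numbers below the order in which every vertex has two
neighbors with coprime (shifted) labels suffices for being neighborhood-prime. -/
theorem isNeighborhoodPrime_of_coprime_neighbors {V : Type*} [Fintype V] (G : SimpleGraph V)
    (l : V → ℕ) (hlt : ∀ v, l v < Fintype.card V) (hinj : Function.Injective l)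
    (h : ∀ v, ∃ a b, G.Adj v a ∧ G.Adj v b ∧ Nat.Coprime (l a + 1) (l b + 1)) :
    G.IsNeighborhoodPrime := by
  have hbij : Function.Bijective (fun v => (⟨l v, hlt v⟩ : Fin (Fintype.card V))) := by
    rw [Fintype.bijective_iff_injective_and_card]
    exact ⟨fun a b hab => hinj (Fin.ext_iff.mp hab), by simp⟩
  refine ⟨Equiv.ofBijective _ hbij, fun v _ => ?_⟩
  obtain ⟨a, b, ha, hb, hab⟩ := h v
  refine Nat.eq_one_of_dvd_coprimes hab ?_ ?_
  · exact Finset.gcd_dvd ((G.mem_neighborFinset v a).2 ha)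
  · exact Finset.gcd_dvd ((G.mem_neighborFinset v b).2 hb)

theorem genPetersen_adj_outer {n k : ℕ} {i j : Fin n} (hne : i ≠ j)
    (h : (j : ℕ) = (i + 1) % n ∨ (i : ℕ) = (j + 1) % n) :
    (genPetersen n k).Adj (.inl i) (.inl j) := by
  simpa [genPetersen, hne] using h

theorem genPetersen_adj_spoke {n k : ℕ} (i : Fin n) :
    (genPetersen n k).Adj (.inl i) (.inr i) := by
  simp [genPetersen]

theorem genPetersen_adj_inner {n k : ℕ} {i j : Fin n} (hne : i ≠ j)
    (h : (j : ℕ) = (i + k) % n ∨ (i : ℕ) = (j + k) % n) :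
    (genPetersen n k).Adj (.inr i) (.inr j) := by
  simpa [genPetersen, hne] using h

/-- A labeling of `GP(4m, 2m)` by `{0, …, 8m - 1}`. The labels of `u_i` and `v_{i+2m}` are
`2t` and `2t + 1` for some `t`, and the labels along the two cyclic sequences of outer vertices
with indices of fixed parity increase by 2, starting from `u_0` and from `u_{2m+1}`. -/
def halfPetersenLabel (m : ℕ) : Fin (4 * m) ⊕ Fin (4 * m) → ℕ
  | .inl i =>
    if (i : ℕ) % 2 = 0 then i else if (i : ℕ) < 2 * m then i + 6 * m - 1 else i + 2 * m - 1
  | .inr i =>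
    if (i : ℕ) % 2 = 1 then i + 4 * m else if (i : ℕ) < 2 * m then i + 2 * m + 1
    else i - 2 * m + 1

theorem halfPetersenLabel_lt (m : ℕ) (x : Fin (4 * m) ⊕ Fin (4 * m)) :
    halfPetersenLabel m x < 8 * m := by
  rcases x with ⟨i, hi⟩ | ⟨i, hi⟩ <;> simp only [halfPetersenLabel] <;> split_ifs <;> omega

theorem halfPetersenLabel_injective (m : ℕ) : Function.Injective (halfPetersenLabel m) := by
  rintro (⟨i, hi⟩ | ⟨i, hi⟩) (⟨j, hj⟩ | ⟨j, hj⟩) h <;>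
    simp only [halfPetersenLabel, Sum.inl.injEq, Sum.inr.injEq, Fin.mk.injEq, reduceCtorEq]
      at h ⊢ <;>
    split_ifs at h <;> omega

theorem _root_.Nat.coprime_add_two_of_odd {a : ℕ} (h : a % 2 = 1) : Nat.Coprime a (a + 2) := by
  rw [Nat.coprime_self_add_right, Nat.coprime_two_right]
  exact Nat.odd_iff.2 h

theorem exists_coprime_neighbors_outer {m : ℕ} (hm : 2 ≤ m) (i : Fin (4 * m)) :
    ∃ a b, (genPetersen (4 * m) (2 * m)).Adj (.inl i) a ∧
      (genPetersen (4 * m) (2 * m)).Adj (.inl i) b ∧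
      Nat.Coprime (halfPetersenLabel m a + 1) (halfPetersenLabel m b + 1) := by
  obtain ⟨i, hi⟩ := i
  have adj_next (hlt : i + 1 < 4 * m) :
      (genPetersen (4 * m) (2 * m)).Adj (.inl ⟨i, hi⟩) (.inl ⟨i + 1, hlt⟩) :=
    genPetersen_adj_outer (by simp) (.inl (Nat.mod_eq_of_lt hlt).symm)
  have adj_prev (hpos : 0 < i) :
      (genPetersen (4 * m) (2 * m)).Adj (.inl ⟨i, hi⟩) (.inl ⟨i - 1, by omega⟩) := by
    refine genPetersen_adj_outer (by simp; omega) (.inr ?_)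
    simp only [Nat.sub_add_cancel hpos, Nat.mod_eq_of_lt hi]
  rcases Nat.eq_zero_or_pos i with rfl | hpos
  · refine ⟨.inl ⟨4 * m - 1, by omega⟩, .inl ⟨1, by omega⟩, ?_, adj_next (by omega), ?_⟩
    · refine genPetersen_adj_outer (by simp; omega) (.inr ?_)
      simp [Nat.sub_add_cancel (show 1 ≤ 4 * m by omega)]
    · convert Nat.coprime_add_two_of_odd (a := 6 * m - 1) (by omega) using 1 <;>
        simp only [halfPetersenLabel] <;> grind
  by_cases hlast : i + 1 = 4 * m
  · refine ⟨.inl ⟨i - 1, by omega⟩, .inl ⟨0, by omega⟩, adj_prev hpos, ?_, ?_⟩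
    · exact genPetersen_adj_outer (by simp; omega) (.inl (by simp [hlast]))
    · simp [halfPetersenLabel]
  by_cases hmid : i = 2 * m
  · refine ⟨.inl ⟨i + 1, by omega⟩, .inr ⟨i, hi⟩, adj_next (by omega),
      genPetersen_adj_spoke _, ?_⟩
    have hv : halfPetersenLabel m (.inr ⟨i, hi⟩) + 1 = 2 := by
      simp only [halfPetersenLabel]; split_ifs <;> omega
    rw [hv, Nat.coprime_two_right, Nat.odd_iff]
    simp only [halfPetersenLabel]; split_ifs <;> omega
  · refine ⟨.inl ⟨i - 1, by omega⟩, .inl ⟨i + 1, by omega⟩, adj_prev hpos,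
      adj_next (by omega), ?_⟩
    convert Nat.coprime_add_two_of_odd
      (a := halfPetersenLabel m (.inl ⟨i - 1, by omega⟩) + 1) ?_ using 1 <;>
      simp only [halfPetersenLabel] <;> split_ifs <;> omega

theorem exists_coprime_neighbors_inner {m : ℕ} (i : Fin (4 * m)) :
    ∃ a b, (genPetersen (4 * m) (2 * m)).Adj (.inr i) a ∧
      (genPetersen (4 * m) (2 * m)).Adj (.inr i) b ∧
      Nat.Coprime (halfPetersenLabel m a + 1) (halfPetersenLabel m b + 1) := by
  obtain ⟨i, hi⟩ := i
  obtain ⟨j, hj, hij⟩ : ∃ j, j < 4 * m ∧ (j = i + 2 * m ∨ i = j + 2 * m) := by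
    by_cases h : i < 2 * m
    · exact ⟨i + 2 * m, by omega, .inl rfl⟩
    · exact ⟨i - 2 * m, by omega, .inr (by omega)⟩
  refine ⟨.inl ⟨i, hi⟩, .inr ⟨j, hj⟩, (genPetersen_adj_spoke _).symm,
    genPetersen_adj_inner (by simp; omega) ?_, ?_⟩
  · refine hij.imp (fun h => ?_) (fun h => ?_)
    · simp only [← h, Nat.mod_eq_of_lt hj]
    · simp only [← h, Nat.mod_eq_of_lt hi]
  · convert Nat.coprime_self_add_right.2 (Nat.coprime_one_right
      (halfPetersenLabel m (.inl ⟨i, hi⟩) + 1)) using 1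
    simp only [halfPetersenLabel]; split_ifs <;> omega

end SimpleGraph

/-- For every integer n ≥ 8 with n ≡ 0 (mod 4), the generalized Petersen
graph GP(n, n/2) is neighborhood-prime. -/
theorem genPetersen_half_isNeighborhoodPrime (n : ℕ) (hn : 8 ≤ n) (h4 : n % 4 = 0) :
    (SimpleGraph.genPetersen n (n / 2)).IsNeighborhoodPrime := by
  obtain ⟨m, rfl⟩ : ∃ m, n = 4 * m := ⟨n / 4, by omega⟩
  rw [show 4 * m / 2 = 2 * m by omega]
  refine SimpleGraph.isNeighborhoodPrime_of_coprime_neighbors _ (SimpleGraph.halfPetersenLabel m)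
    (fun x => ?_) (SimpleGraph.halfPetersenLabel_injective m) ?_
  · have := SimpleGraph.halfPetersenLabel_lt m x
    simp only [Fintype.card_sum, Fintype.card_fin]
    omega
  · rintro (i | i)
    · exact SimpleGraph.exists_coprime_neighbors_outer (by omega) i
    · exact SimpleGraph.exists_coprime_neighbors_inner i
end

section
/- The grid graph P_m × P_n is neighborhood-prime if m and n are both even, or if at least one of m or n is congruent to 0 modulo 4. -/
namespace SimpleGraph

/-- The grid graph `P_m × P_n`: the Cartesian (box) product of the path on `m` vertices
with the path on `n` vertices. -/
def gridGraph (m n : ℕ) : SimpleGraph (Fin m × Fin n) :=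
  (SimpleGraph.pathGraph m).boxProd (SimpleGraph.pathGraph n)

end SimpleGraph

namespace SimpleGraph

/-- Being neighborhood-prime is invariant under graph isomorphism. -/
theorem IsNeighborhoodPrime.of_iso {V W : Type*} [Fintype V] [Fintype W] {G : SimpleGraph V}
    {H : SimpleGraph W} (e : G ≃g H) (hG : G.IsNeighborhoodPrime) : H.IsNeighborhoodPrime := by
  classical
  obtain ⟨f, hf⟩ := hG
  refine ⟨e.symm.toEquiv.trans (f.trans (finCongr (Fintype.card_congr e.toEquiv))), fun w hw => ?_⟩
  have hN : H.neighborFinset w = (G.neighborFinset (e.symm w)).image e := by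
    ext x
    simp only [mem_neighborFinset, Finset.mem_image]
    constructor
    · intro hx
      exact ⟨e.symm x, e.symm.map_adj_iff.2 hx, e.apply_symm_apply x⟩
    · rintro ⟨y, hy, rfl⟩
      simpa using e.map_adj_iff.2 hy
  have hdeg : 2 ≤ G.degree (e.symm w) := by
    rw [← card_neighborFinset_eq_degree, hN] at hw
    rw [← card_neighborFinset_eq_degree]
    exact hw.trans Finset.card_image_le
  have key := hf (e.symm w) (by convert hdeg)
  have hgcd : (H.neighborFinset w).gcd (fun u => (f (e.symm u) : ℕ) + 1) = 1 := by
    rw [hN, Finset.gcd_image]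
    simpa [Function.comp_def] using key
  convert hgcd using 2
  rfl

/-- An injective labeling by `{0, …, |V| - 1}` such that every vertex with two distinct neighbors
sees two labels whose successors are coprime witnesses that the graph is neighborhood-prime. -/
theorem isNeighborhoodPrime_of_coprime_labels_s6 {V : Type*} [Fintype V] {G : SimpleGraph V}
    (g : V → ℕ) (hinj : Function.Injective g) (hlt : ∀ v, g v < Fintype.card V)
    (h : ∀ v a b, G.Adj v a → G.Adj v b → a ≠ b →
      ∃ u w, G.Adj v u ∧ G.Adj v w ∧ Nat.Coprime (g u + 1) (g w + 1)) :
    G.IsNeighborhoodPrime := by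
  classical
  have hbij : Function.Bijective (fun v => (⟨g v, hlt v⟩ : Fin (Fintype.card V))) := by
    rw [Fintype.bijective_iff_injective_and_card]
    exact ⟨fun a b hab => hinj (by simpa using hab), by simp⟩
  refine ⟨Equiv.ofBijective _ hbij, fun v hv => ?_⟩
  rw [← card_neighborFinset_eq_degree] at hv
  obtain ⟨a, ha, b, hb, hab⟩ := Finset.one_lt_card.1 hv
  rw [mem_neighborFinset] at ha hb
  obtain ⟨u, w, hu, hw, huw⟩ := h v a b ha hb hab
  refine Nat.eq_one_of_dvd_coprimes huw ?_ ?_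
  · exact Finset.gcd_dvd (f := fun u => g u + 1) ((mem_neighborFinset _ _ _).2 hu)
  · exact Finset.gcd_dvd (f := fun u => g u + 1) ((mem_neighborFinset _ _ _).2 hw)

/-- The position of the cell `(a, j)` in a strip of height two that is read off in `2 × 2` blocks,
each block listing its diagonal and then its antidiagonal. -/
def stripLabel (a j : ℕ) : ℕ :=
  4 * (j / 2) + if a = j % 2 then a else 2 + a

/-- A labeling of a grid with `2 * h` columns: the first `s` rows (where `s ≤ 1`) are labeled like
a path, the remaining ones in strips of height two. -/
def gridLabel (s h i j : ℕ) : ℕ :=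
  if i < s then (if j % 2 = 0 then h - 1 - j / 2 else 2 * h - 1 - j / 2)
  else 2 * h * s + (4 * h * ((i - s) / 2) + stripLabel ((i - s) % 2) j)

theorem stripLabel_lt {a j h : ℕ} (ha : a < 2) (hj : j < 2 * h) : stripLabel a j < 4 * h := by
  unfold stripLabel
  split_ifs <;> omega

theorem stripLabel_inj {a j a' j' : ℕ} (ha : a < 2) (ha' : a' < 2)
    (h : stripLabel a j = stripLabel a' j') : a = a' ∧ j = j' := by
  unfold stripLabel at h
  split_ifs at h <;> omega

theorem gridLabel_of_le {s h i j : ℕ} (hi : s ≤ i) : gridLabel s h i j =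
    2 * h * s + (4 * h * ((i - s) / 2) + stripLabel ((i - s) % 2) j) :=
  if_neg hi.not_gt

theorem gridLabel_of_lt {s h i j : ℕ} (hi : i < s) : gridLabel s h i j =
    if j % 2 = 0 then h - 1 - j / 2 else 2 * h - 1 - j / 2 :=
  if_pos hi

theorem gridLabel_lt_of_lt {s h i j : ℕ} (hi : i < s) (hj : j < 2 * h) :
    gridLabel s h i j < 2 * h * s := by
  have : 2 * h * 1 ≤ 2 * h * s := Nat.mul_le_mul_left _ (by omega)
  rw [gridLabel_of_lt hi]
  split_ifs <;> omega

theorem le_gridLabel {s h i j : ℕ} (hi : s ≤ i) : 2 * h * s ≤ gridLabel s h i j := by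
  rw [gridLabel_of_le hi]
  omega

theorem gridLabel_lt {s k h i j : ℕ} (hi : i < s + 2 * k) (hj : j < 2 * h) :
    gridLabel s h i j < (s + 2 * k) * (2 * h) := by
  rcases lt_or_ge i s with his | his
  · have := gridLabel_lt_of_lt his hj
    nlinarith [Nat.zero_le (k * h)]
  · rw [gridLabel_of_le his]
    have h1 := stripLabel_lt (a := (i - s) % 2) (Nat.mod_lt _ two_pos) hj
    have h2 : 4 * h * ((i - s) / 2 + 1) ≤ 4 * h * k := Nat.mul_le_mul_left _ (by omega)
    linarith

theorem gridLabel_inj {s h i j i' j' : ℕ} (hs : s ≤ 1) (hj : j < 2 * h) (hj' : j' < 2 * h)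
    (heq : gridLabel s h i j = gridLabel s h i' j') : i = i' ∧ j = j' := by
  rcases lt_or_ge i s with his | his <;> rcases lt_or_ge i' s with his' | his'
  · rw [gridLabel_of_lt his, gridLabel_of_lt his'] at heq
    split_ifs at heq <;> omega
  · have := gridLabel_lt_of_lt his hj
    have := le_gridLabel (h := h) (j := j') his'
    omega
  · have := gridLabel_lt_of_lt his' hj'
    have := le_gridLabel (h := h) (j := j) his
    omega
  · rw [gridLabel_of_le his, gridLabel_of_le his'] at heq
    have heq := Nat.add_left_cancel heq
    have ha : (i - s) % 2 < 2 := Nat.mod_lt _ two_pos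
    have ha' : (i' - s) % 2 < 2 := Nat.mod_lt _ two_pos
    have h1 := stripLabel_lt ha hj
    have h2 := stripLabel_lt ha' hj'
    have hdiv := congrArg (· / (4 * h)) heq
    have hmod := congrArg (· % (4 * h)) heq
    simp only [Nat.mul_add_mod, Nat.mod_eq_of_lt h1, Nat.mod_eq_of_lt h2] at hmod
    simp only [Nat.mul_add_div (show 0 < 4 * h by omega), Nat.div_eq_of_lt h1,
      Nat.div_eq_of_lt h2, add_zero] at hdiv
    have := stripLabel_inj ha ha' hmod
    omega

/-- Diagonally opposite cells of a block carry consecutive labels. -/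
theorem gridLabel_diag {s h p q : ℕ} :
    gridLabel s h (s + 2 * p + 1) (2 * q + 1) = gridLabel s h (s + 2 * p) (2 * q) + 1 := by
  rw [gridLabel_of_le (by omega), gridLabel_of_le (by omega),
    show (s + 2 * p + 1 - s) / 2 = p by omega, show (s + 2 * p - s) / 2 = p by omega,
    show (s + 2 * p + 1 - s) % 2 = 1 by omega, show (s + 2 * p - s) % 2 = 0 by omega]
  unfold stripLabel
  split_ifs <;> omega

theorem gridLabel_antidiag {s h p q : ℕ} :
    gridLabel s h (s + 2 * p + 1) (2 * q) = gridLabel s h (s + 2 * p) (2 * q + 1) + 1 := by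
  rw [gridLabel_of_le (by omega), gridLabel_of_le (by omega),
    show (s + 2 * p + 1 - s) / 2 = p by omega, show (s + 2 * p - s) / 2 = p by omega,
    show (s + 2 * p + 1 - s) % 2 = 1 by omega, show (s + 2 * p - s) % 2 = 0 by omega]
  unfold stripLabel
  split_ifs <;> omega

theorem gridGraph_adj {m n : ℕ} {x y : Fin m × Fin n} : (gridGraph m n).Adj x y ↔
    ((x.1.val + 1 = y.1.val ∨ y.1.val + 1 = x.1.val) ∧ x.2.val = y.2.val) ∨
      ((x.2.val + 1 = y.2.val ∨ y.2.val + 1 = x.2.val) ∧ x.1.val = y.1.val) := by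
  simp [gridGraph, boxProd_adj, pathGraph_adj, Fin.ext_iff]

theorem gridGraph_isNeighborhoodPrime_of_even_right (m n : ℕ) (hn : Even n) :
    (gridGraph m n).IsNeighborhoodPrime := by
  obtain ⟨h, rfl⟩ := hn.two_dvd
  obtain ⟨s, k, hs, rfl⟩ : ∃ s k, s ≤ 1 ∧ m = s + 2 * k :=
    ⟨m % 2, m / 2, by omega, by omega⟩
  refine isNeighborhoodPrime_of_coprime_labels_s6
    (fun x => gridLabel s h x.1 x.2) ?_ ?_ ?_
  · rintro ⟨i, j⟩ ⟨i', j'⟩ heq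
    have := gridLabel_inj hs j.2 j'.2 heq
    simpa [Fin.ext_iff] using this
  · rintro ⟨i, j⟩
    simpa using gridLabel_lt i.2 j.2
  rintro ⟨⟨i, hi⟩, ⟨j, hj⟩⟩ ⟨⟨a, ha⟩, ⟨b, hb⟩⟩ ⟨⟨c, hc⟩, ⟨d, hd⟩⟩ hab hcd hne
  simp only [gridGraph_adj, ne_eq, Prod.mk.injEq, Fin.mk.injEq] at hab hcd hne
  suffices ∃ a b c d, (a < s + 2 * k ∧ b < 2 * h) ∧ (c < s + 2 * k ∧ d < 2 * h) ∧
      (((i + 1 = a ∨ a + 1 = i) ∧ j = b) ∨ ((j + 1 = b ∨ b + 1 = j) ∧ i = a)) ∧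
      (((i + 1 = c ∨ c + 1 = i) ∧ j = d) ∨ ((j + 1 = d ∨ d + 1 = j) ∧ i = c)) ∧
      (gridLabel s h a b = 0 ∨ gridLabel s h c d = gridLabel s h a b + 1) by
    obtain ⟨a, b, c, d, ⟨ha, hb⟩, ⟨hc, hd⟩, h1, h2, h3⟩ := this
    refine ⟨(⟨a, ha⟩, ⟨b, hb⟩), (⟨c, hc⟩, ⟨d, hd⟩), gridGraph_adj.2 h1, gridGraph_adj.2 h2, ?_⟩
    rcases h3 with h3 | h3 <;> simp [h3]
  rcases lt_or_ge i s with his | his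
  · obtain rfl : s = 1 := by omega
    obtain rfl : i = 0 := by omega
    rcases Nat.eq_zero_or_pos j with rfl | hj0
    · refine ⟨0, 1, 1, 0, by omega, by omega, by omega, by omega, Or.inr ?_⟩
      rw [gridLabel_of_le le_rfl, gridLabel_of_lt one_pos]
      simp [stripLabel]
      omega
    rcases eq_or_ne (j + 1) (2 * h) with hjn | hjn
    · refine ⟨0, j - 1, 0, j - 1, by omega, by omega, by omega, by omega, Or.inl ?_⟩
      rw [gridLabel_of_lt one_pos]
      split_ifs <;> omega
    · refine ⟨0, j + 1, 0, j - 1, by omega, by omega, by omega, by omega, Or.inr ?_⟩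
      rw [gridLabel_of_lt one_pos, gridLabel_of_lt one_pos]
      split_ifs <;> omega
  · obtain ⟨p, hp⟩ : ∃ p, i = s + 2 * p ∨ i = s + 2 * p + 1 := ⟨(i - s) / 2, by omega⟩
    obtain ⟨q, hq⟩ : ∃ q, j = 2 * q ∨ j = 2 * q + 1 := ⟨j / 2, by omega⟩
    by_cases hpar : i = s + 2 * p ↔ j = 2 * q
    · exact ⟨s + 2 * p, 2 * q + 1, s + 2 * p + 1, 2 * q, by omega, by omega, by omega, by omega,
        Or.inr gridLabel_antidiag⟩
    · exact ⟨s + 2 * p, 2 * q, s + 2 * p + 1, 2 * q + 1, by omega, by omega, by omega, by omega,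
        Or.inr gridLabel_diag⟩

end SimpleGraph

/-- The grid graph P_m × P_n is neighborhood-prime if m and n are both even,
or if at least one of m or n is congruent to 0 modulo 4. -/
theorem gridGraph_even_isNeighborhoodPrime (m n : ℕ) (hm : 1 ≤ m) (hn : 1 ≤ n)
    (h : (Even m ∧ Even n) ∨ m % 4 = 0 ∨ n % 4 = 0) :
    (SimpleGraph.gridGraph m n).IsNeighborhoodPrime := by
  have hmn : Even m ∨ Even n := by
    simp only [Nat.even_iff] at h ⊢
    omega
  rcases hmn with hm2 | hn2
  · exact (SimpleGraph.gridGraph_isNeighborhoodPrime_of_even_right n m hm2).of_iso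
      (SimpleGraph.boxProdComm _ _)
  · exact SimpleGraph.gridGraph_isNeighborhoodPrime_of_even_right m n hn2
end

section
/- For all positive integers m and n, the grid graph P_m × P_n is neighborhood-prime. -/
namespace SimpleGraph

/-- A graph is neighborhood-prime as soon as its vertices can be linearly ordered (through an
injective key) so that every vertex with two distinct neighbors is adjacent either to the least
vertex or to two consecutive vertices. -/
lemma isNeighborhoodPrime_of_key {V α : Type*} [Fintype V] [LinearOrder α] (G : SimpleGraph V)
    (k : V → α) (hk : Function.Injective k)
    (h : ∀ v x y, G.Adj v x → G.Adj v y → x ≠ y → ∃ a, G.Adj v a ∧ ((∀ w, k a ≤ k w) ∨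
      ∃ b, G.Adj v b ∧ k a < k b ∧ ∀ w, k a < k w → k b ≤ k w)) :
    G.IsNeighborhoodPrime := by
  classical
  let _ : LinearOrder V := LinearOrder.lift' k hk
  have hle (a b : V) : k a ≤ k b ↔ a ≤ b := Iff.rfl
  have hlt (a b : V) : k a < k b ↔ a < b := Iff.rfl
  let e : V ≃o Fin (Fintype.card V) := (Fintype.orderIsoFinOfCardEq V rfl).symm
  refine ⟨e.toEquiv, fun v hv => ?_⟩
  obtain ⟨x, hx, y, hy, hxy⟩ := Finset.one_lt_card.1 hv
  rw [mem_neighborFinset] at hx hy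
  obtain ⟨a, ha, hmin | ⟨b, hb, hab, hcov⟩⟩ := h v x y hx hy hxy
  all_goals
    have hda := Finset.gcd_dvd (f := fun u => (e u : ℕ) + 1)
      ((G.mem_neighborFinset v a).2 ha)
  · have hpos : 0 < Fintype.card V := Fintype.card_pos_iff.2 ⟨v⟩
    have h0 : e a ≤ ⟨0, hpos⟩ := by
      rw [← e.le_symm_apply, ← hle]
      exact hmin _
    have h0' : (e a : ℕ) = 0 := Nat.le_zero.1 h0
    simpa [h0'] using hda
  · have hdb := Finset.gcd_dvd (f := fun u => (e u : ℕ) + 1)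
      ((G.mem_neighborFinset v b).2 hb)
    have hcov' : a ⋖ b := by
      refine ⟨(hlt _ _).1 hab, fun c hac hcb => ?_⟩
      exact absurd ((hle _ _).1 (hcov c ((hlt _ _).2 hac))) (not_le.2 hcb)
    have hsucc : (e a : ℕ) + 1 = e b :=
      Nat.covBy_iff_add_one_eq.1 (Fin.covBy_iff.1 ((apply_covBy_apply_iff e).2 hcov'))
    beta_reduce at hda hdb
    rw [← hsucc] at hdb
    exact Nat.dvd_one.1 ((Nat.dvd_add_right hda).1 hdb)

lemma gridGraph_adj_s10 {m n : ℕ} {u v : Fin m × Fin n} :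
    (gridGraph m n).Adj u v ↔
      ((u.1 : ℕ) + 1 = v.1 ∨ (v.1 : ℕ) + 1 = u.1) ∧ (u.2 : ℕ) = v.2 ∨
      ((u.2 : ℕ) + 1 = v.2 ∨ (v.2 : ℕ) + 1 = u.2) ∧ (u.1 : ℕ) = v.1 := by
  simp [gridGraph, boxProd_adj, pathGraph_adj, Fin.ext_iff]

/-- A grid one of whose sides is a single vertex is neighborhood-prime: list the vertices of one
color class in their natural order, then those of the other. -/
lemma gridGraph_isNeighborhoodPrime_of_eq_one {m n : ℕ} (h : m = 1 ∨ n = 1) :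
    (gridGraph m n).IsNeighborhoodPrime := by
  refine isNeighborhoodPrime_of_key _
    (fun v => toLex (((v.1 : ℕ) + v.2) % 2, (v.1 : ℕ) + v.2)) ?_ ?_
  · rintro ⟨⟨i, hi⟩, ⟨j, hj⟩⟩ ⟨⟨i', hi'⟩, ⟨j', hj'⟩⟩ huv
    simp only [EmbeddingLike.apply_eq_iff_eq, Prod.mk.injEq, Fin.mk.injEq] at huv ⊢
    omega
  · have key (v x y : Fin m × Fin n) (hx : (gridGraph m n).Adj v x)
        (hy : (gridGraph m n).Adj v y) (hxy : (x.1 : ℕ) + x.2 < y.1 + y.2) :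
        (x.1 : ℕ) + x.2 + 2 = y.1 + y.2 := by
      rw [gridGraph_adj_s10] at hx hy
      omega
    intro v x y hx hy hxy
    rw [Ne, Prod.ext_iff, Fin.ext_iff, Fin.ext_iff] at hxy
    rcases lt_trichotomy ((x.1 : ℕ) + x.2) (y.1 + y.2) with hlt | heq | hlt
    · have := key v x y hx hy hlt
      refine ⟨x, hx, Or.inr ⟨y, hy, ?_, fun w => ?_⟩⟩ <;>
        simp only [Prod.Lex.toLex_lt_toLex, Prod.Lex.toLex_le_toLex] <;> omega
    · omega
    · have := key v y x hy hx hlt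
      refine ⟨y, hy, Or.inr ⟨x, hx, ?_, fun w => ?_⟩⟩ <;>
        simp only [Prod.Lex.toLex_lt_toLex, Prod.Lex.toLex_le_toLex] <;> omega

/-- The order in which the antidiagonals of the `m × n` grid are listed: first the one of index
`n - 2`, then those of index `m - 2` and `m`, then the others. -/
def antidiagonalRank (m n s : ℕ) : ℕ :=
  if s + 2 = n then 0 else if s + 2 = m then 1 else if s = m then 2 else s + 3

/-- The position of the vertex in row `i` within the antidiagonal of index `s`. Rows are listed
increasingly, except on one antidiagonal, on which they are listed decreasingly. -/
def antidiagonalPos (m n s i : ℕ) : ℕ :=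
  if (n = m + 2 ∧ s + 2 = m) ∨ (n ≠ m + 2 ∧ s = m) then m - i else i

lemma antidiagonalRank_injective (m n : ℕ) : Function.Injective (antidiagonalRank m n) := by
  intro s t h
  unfold antidiagonalRank at h
  split_ifs at h <;> omega

/-- The key listing the grid antidiagonal by antidiagonal. -/
def gridKey (m n : ℕ) (v : Fin m × Fin n) : ℕ ×ₗ ℕ :=
  toLex (antidiagonalRank m n (v.1 + v.2), antidiagonalPos m n (v.1 + v.2) v.1)

lemma gridKey_injective (m n : ℕ) : Function.Injective (gridKey m n) := by
  rintro ⟨⟨i, hi⟩, ⟨j, hj⟩⟩ ⟨⟨i', hi'⟩, ⟨j', hj'⟩⟩ huv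
  simp only [gridKey, EmbeddingLike.apply_eq_iff_eq, Prod.mk.injEq, Fin.mk.injEq] at huv ⊢
  obtain ⟨h1, h2⟩ := huv
  have hs := antidiagonalRank_injective m n h1
  rw [hs] at h2
  unfold antidiagonalPos at h2
  split_ifs at h2 <;> omega

/-- Two vertices that are next to each other on an antidiagonal are consecutive for `gridKey`. -/
lemma gridKey_consecutive {m n : ℕ} {x y : Fin m × Fin n}
    (h1 : (x.1 : ℕ) + 1 = y.1) (h2 : (y.2 : ℕ) + 1 = x.2) :
    (gridKey m n x < gridKey m n y ∧
      ∀ w, gridKey m n x < gridKey m n w → gridKey m n y ≤ gridKey m n w) ∨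
    (gridKey m n y < gridKey m n x ∧
      ∀ w, gridKey m n y < gridKey m n w → gridKey m n x ≤ gridKey m n w) := by
  have hs : (x.1 : ℕ) + x.2 = y.1 + y.2 := by omega
  have hx := x.1.isLt
  have hy := y.1.isLt
  simp only [gridKey, Prod.Lex.toLex_lt_toLex, Prod.Lex.toLex_le_toLex, hs, lt_irrefl, true_and,
    false_or]
  have hpos : antidiagonalPos m n (y.1 + y.2) x.1 + 1 = antidiagonalPos m n (y.1 + y.2) y.1 ∨
      antidiagonalPos m n (y.1 + y.2) y.1 + 1 = antidiagonalPos m n (y.1 + y.2) x.1 := by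
    unfold antidiagonalPos
    split_ifs <;> omega
  rcases hpos with h | h
  · refine Or.inl ⟨by omega, fun w hw => ?_⟩
    rcases hw with hw | ⟨hw, hw'⟩
    · exact Or.inl hw
    · exact Or.inr ⟨hw, by omega⟩
  · refine Or.inr ⟨by omega, fun w hw => ?_⟩
    rcases hw with hw | ⟨hw, hw'⟩
    · exact Or.inl hw
    · exact Or.inr ⟨hw, by omega⟩

/-- The vertex before the corner `(0, n - 1)` in the top row is the least one. -/
lemma gridKey_le_of_corner {m n : ℕ} {x : Fin m × Fin n} (h1 : (x.1 : ℕ) = 0)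
    (h2 : (x.2 : ℕ) + 2 = n) (w : Fin m × Fin n) : gridKey m n x ≤ gridKey m n w := by
  have hw := w.1.isLt
  simp only [gridKey, Prod.Lex.toLex_le_toLex, antidiagonalRank, antidiagonalPos]
  split_ifs <;> omega

/-- The two neighbors of the corner `(m - 1, 0)` are consecutive for `gridKey`. -/
lemma gridKey_consecutive_of_corner {m n : ℕ} {x y : Fin m × Fin n}
    (hx1 : (x.1 : ℕ) + 2 = m) (hx2 : (x.2 : ℕ) = 0)
    (hy1 : (y.1 : ℕ) + 1 = m) (hy2 : (y.2 : ℕ) = 1) :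
    (gridKey m n x < gridKey m n y ∧
      ∀ w, gridKey m n x < gridKey m n w → gridKey m n y ≤ gridKey m n w) ∨
    (gridKey m n y < gridKey m n x ∧
      ∀ w, gridKey m n y < gridKey m n w → gridKey m n x ≤ gridKey m n w) := by
  have hxs : (x.1 : ℕ) + x.2 + 2 = m := by omega
  have hys : (y.1 : ℕ) + y.2 = m := by omega
  have hw1 (w : Fin m × Fin n) : (w.1 : ℕ) < m := w.1.isLt
  simp only [gridKey, Prod.Lex.toLex_lt_toLex, Prod.Lex.toLex_le_toLex, hys]
  by_cases h : n = m + 2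
  · have hrx : antidiagonalRank m n (x.1 + x.2) = 1 := by
      unfold antidiagonalRank
      split_ifs <;> omega
    have hry : antidiagonalRank m n m = 0 := by simp [antidiagonalRank, h]
    have hpx : antidiagonalPos m n (x.1 + x.2) x.1 = 2 := by
      rw [antidiagonalPos, if_pos (Or.inl ⟨h, hxs⟩)]
      omega
    have hpy : antidiagonalPos m n m y.1 = y.1 := if_neg (by omega)
    rw [hrx, hry, hpx, hpy]
    refine Or.inr ⟨by omega, fun w => ?_⟩
    have := hw1 w
    unfold antidiagonalRank antidiagonalPos
    split_ifs <;> omega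
  · have hrx : n = m ∧ antidiagonalRank m n (x.1 + x.2) = 0 ∨
        n ≠ m ∧ antidiagonalRank m n (x.1 + x.2) = 1 := by
      unfold antidiagonalRank
      split_ifs <;> omega
    have hry : antidiagonalRank m n m = 2 := by
      unfold antidiagonalRank
      split_ifs <;> omega
    have hpx : antidiagonalPos m n (x.1 + x.2) x.1 = x.1 := if_neg (by omega)
    have hpy : antidiagonalPos m n m y.1 = 1 := by
      rw [antidiagonalPos, if_pos (Or.inr ⟨h, rfl⟩)]
      omega
    rw [hry, hpx, hpy]
    refine Or.inl ⟨by omega, fun w => ?_⟩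
    have := hw1 w
    rcases hrx with ⟨hnm, hrx⟩ | ⟨hnm, hrx⟩
    all_goals
      rw [hrx]
      unfold antidiagonalRank antidiagonalPos
      split_ifs <;> first | omega | simp

lemma gridGraph_isNeighborhoodPrime_of_two_le {m n : ℕ} (hm : 2 ≤ m) (hn : 2 ≤ n) :
    (gridGraph m n).IsNeighborhoodPrime := by
  refine isNeighborhoodPrime_of_key _ (gridKey m n) (gridKey_injective m n) ?_
  intro v _ _ _ _ _
  have pair {x y : Fin m × Fin n} (hx : (gridGraph m n).Adj v x) (hy : (gridGraph m n).Adj v y)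
      (h : (gridKey m n x < gridKey m n y ∧
          ∀ w, gridKey m n x < gridKey m n w → gridKey m n y ≤ gridKey m n w) ∨
        (gridKey m n y < gridKey m n x ∧
          ∀ w, gridKey m n y < gridKey m n w → gridKey m n x ≤ gridKey m n w)) :
      ∃ a, (gridGraph m n).Adj v a ∧ ((∀ w, gridKey m n a ≤ gridKey m n w) ∨
        ∃ b, (gridGraph m n).Adj v b ∧ gridKey m n a < gridKey m n b ∧
          ∀ w, gridKey m n a < gridKey m n w → gridKey m n b ≤ gridKey m n w) := by
    rcases h with h | h
    · exact ⟨x, hx, Or.inr ⟨y, hy, h⟩⟩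
    · exact ⟨y, hy, Or.inr ⟨x, hx, h⟩⟩
  obtain ⟨⟨i, hi⟩, ⟨j, hj⟩⟩ := v
  by_cases hlow : 0 < i ∧ 0 < j
  · apply pair (x := (⟨i - 1, by omega⟩, ⟨j, hj⟩)) (y := (⟨i, hi⟩, ⟨j - 1, by omega⟩))
    · rw [gridGraph_adj_s10]; dsimp only; omega
    · rw [gridGraph_adj_s10]; dsimp only; omega
    · apply gridKey_consecutive <;> dsimp only <;> omega
  by_cases hhigh : i + 1 < m ∧ j + 1 < n
  · apply pair (x := (⟨i, hi⟩, ⟨j + 1, by omega⟩)) (y := (⟨i + 1, by omega⟩, ⟨j, hj⟩))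
    · rw [gridGraph_adj_s10]; dsimp only; omega
    · rw [gridGraph_adj_s10]; dsimp only; omega
    · apply gridKey_consecutive <;> dsimp only
  by_cases hi0 : i = 0
  · refine ⟨(⟨i, hi⟩, ⟨j - 1, by omega⟩), ?_, Or.inl (gridKey_le_of_corner ?_ ?_)⟩
    · rw [gridGraph_adj_s10]; dsimp only; omega
    · exact hi0
    · dsimp only; omega
  · apply pair (x := (⟨i - 1, by omega⟩, ⟨j, hj⟩)) (y := (⟨i, hi⟩, ⟨j + 1, by omega⟩))
    · rw [gridGraph_adj_s10]; dsimp only; omega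
    · rw [gridGraph_adj_s10]; dsimp only; omega
    · apply gridKey_consecutive_of_corner <;> dsimp only <;> omega

end SimpleGraph

/-- For all positive integers m and n, the grid graph P_m × P_n is
neighborhood-prime. -/
theorem gridGraph_isNeighborhoodPrime (m n : ℕ) (hm : 1 ≤ m) (hn : 1 ≤ n) :
    (SimpleGraph.gridGraph m n).IsNeighborhoodPrime := by
  by_cases h : m = 1 ∨ n = 1
  · exact SimpleGraph.gridGraph_isNeighborhoodPrime_of_eq_one h
  · exact SimpleGraph.gridGraph_isNeighborhoodPrime_of_two_le (by omega) (by omega)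
end

section
/- Every simple graph of order n ≥ 3 with minimum degree at least n/2 is neighborhood-prime. -/
open scoped Classical

theorem Nat.two_mul_lt_centralBinom {m : ℕ} (hm : 2 ≤ m) : 2 * m < m.centralBinom := by
  induction m, hm using Nat.le_induction with
  | base => decide
  | succ k hk ih =>
    have h := Nat.succ_mul_centralBinom_succ k
    nlinarith

/-- A type with `n ≥ 3` elements, together with a family, indexed by that type, of sets with at
least `n / 2` elements, has a subset of size `⌊n / 2⌋` that is not in the family. -/
theorem exists_card_eq_half_forall_ne {V : Type*} [Fintype V] (hn : 3 ≤ Fintype.card V)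
    (N : V → Finset V) (hN : ∀ v, Fintype.card V ≤ 2 * (N v).card) :
    ∃ S : Finset V, S.card = Fintype.card V / 2 ∧ ∀ v, N v ≠ S := by
  by_contra! h
  rcases Nat.even_or_odd' (Fintype.card V) with ⟨m, hm | hm⟩
  · have hsub : Finset.univ.powersetCard (Fintype.card V / 2) ⊆ Finset.univ.image N := by
      intro S hS
      obtain ⟨v, hv⟩ := h S (Finset.mem_powersetCard.1 hS).2
      exact Finset.mem_image.2 ⟨v, Finset.mem_univ v, hv⟩
    have hle := (Finset.card_le_card hsub).trans Finset.card_image_le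
    have hlt := Nat.two_mul_lt_centralBinom (m := m) (by omega)
    rw [Finset.card_powersetCard, Finset.card_univ, hm, Nat.mul_div_cancel_left m two_pos,
      ← Nat.centralBinom_eq_two_mul_choose] at hle
    omega
  · obtain ⟨S, -, hS⟩ := Finset.exists_subset_card_eq (s := (Finset.univ : Finset V))
      (n := Fintype.card V / 2) (by rw [Finset.card_univ]; omega)
    obtain ⟨v, rfl⟩ := h S hS
    have := hN v
    omega

/-- The number of labels in `{1, …, n}` divisible by `d` is `⌊n / d⌋`. -/
theorem card_filter_dvd_label {V : Type*} [Fintype V] {n : ℕ} (f : V ≃ Fin n) (d : ℕ) :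
    (Finset.univ.filter fun u => d ∣ (f u : ℕ) + 1).card = n / d := by
  rw [← Nat.Ioc_filter_dvd_card_eq_div n d]
  refine Finset.card_bij (fun u _ => (f u : ℕ) + 1) ?_ ?_ ?_
  · intro u hu
    have := (f u).isLt
    simp only [Finset.mem_filter, Finset.mem_univ, true_and, Finset.mem_Ioc] at hu ⊢
    exact ⟨by omega, hu⟩
  · intro a _ b _ hab
    exact f.injective (Fin.ext (Nat.succ_injective hab))
  · intro k hk
    simp only [Finset.mem_filter, Finset.mem_Ioc] at hk
    obtain ⟨⟨hk0, hkn⟩, hdk⟩ := hk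
    have hk1 : k - 1 + 1 = k := by omega
    refine ⟨f.symm ⟨k - 1, by omega⟩, ?_, ?_⟩ <;> simp [hk1, hdk]

/-- Any set of `⌊n / 2⌋` elements is the set of elements with even label in some labeling. -/
theorem exists_labeling_even_iff_mem {V : Type*} [Fintype V] (S : Finset V)
    (hS : S.card = Fintype.card V / 2) :
    ∃ f : V ≃ Fin (Fintype.card V), ∀ u, 2 ∣ (f u : ℕ) + 1 ↔ u ∈ S := by
  let g := Fintype.equivFin V
  let T := Finset.univ.filter fun u => 2 ∣ (g u : ℕ) + 1
  let e : {u // u ∈ S} ≃ {u // u ∈ T} :=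
    Finset.equivOfCardEq (hS.trans (card_filter_dvd_label g 2).symm)
  have hT : ∀ u, 2 ∣ (g u : ℕ) + 1 ↔ u ∈ T := by simp [T]
  refine ⟨e.extendSubtype.trans g, fun u => ?_⟩
  rw [Equiv.trans_apply, hT]
  by_cases hu : u ∈ S
  · exact iff_of_true (e.extendSubtype_mem u hu) hu
  · exact iff_of_false (e.extendSubtype_not_mem u hu) hu

/-- Every simple graph of order n ≥ 3 with minimum degree at least n/2 is
neighborhood-prime.  (The condition `card V ≤ 2 * degree v` for every vertex `v` says
precisely that every degree is at least n/2.) -/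
theorem minDegree_half_isNeighborhoodPrime {V : Type*} [Fintype V] (G : SimpleGraph V)
    (hn : 3 ≤ Fintype.card V)
    (hdeg : ∀ v : V, Fintype.card V ≤ 2 * G.degree v) :
    G.IsNeighborhoodPrime := by
  obtain ⟨S, hS, hne⟩ := exists_card_eq_half_forall_ne hn (fun v => G.neighborFinset v) hdeg
  obtain ⟨f, hf⟩ := exists_labeling_even_iff_mem S hS
  refine ⟨f, fun v _ => ?_⟩
  have hcard : Fintype.card V ≤ 2 * (G.neighborFinset v).card := hdeg v
  set d := (G.neighborFinset v).gcd (fun u => (f u : ℕ) + 1)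
  have hdvd : ∀ u ∈ G.neighborFinset v, d ∣ (f u : ℕ) + 1 := fun u hu => Finset.gcd_dvd hu
  have hle : (G.neighborFinset v).card ≤ Fintype.card V / d := by
    rw [← card_filter_dvd_label f d]
    exact Finset.card_le_card fun u hu => by simpa using hdvd u hu
  by_contra hd1
  rcases (by omega : d = 0 ∨ d = 2 ∨ 3 ≤ d) with h0 | h2 | h3
  · rw [h0, Nat.div_zero] at hle
    omega
  · rw [h2] at hdvd
    refine hne v (Finset.eq_of_subset_of_card_le (fun u hu => (hf u).1 (hdvd u hu)) ?_)
    omega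
  · have := Nat.div_le_div_left (a := Fintype.card V) h3 (by norm_num)
    omega
end

section
/- Let G be a simple graph of order n ≥ 6. If the maximum degree of G satisfies Δ(G) ≥ n − π(n) + π(⌊n/2⌋) − 1, then G is neighborhood-prime. -/
open scoped Classical

namespace SimpleGraph

/-- The primes in the upper half of `{1, …, n}`. -/
def largePrimes (n : ℕ) : Finset ℕ := (Finset.Ioc (n / 2) n).filter Nat.Prime

lemma card_largePrimes (n : ℕ) :
    Nat.primeCounting (n / 2) + (largePrimes n).card = Nat.primeCounting n := by
  simp only [Nat.primeCounting, Nat.primeCounting', Nat.count_eq_card_filter_range, largePrimes]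
  rw [← Finset.card_union_of_disjoint]
  · congr 1
    ext p
    have := Nat.div_le_self n 2
    simp only [Finset.mem_union, Finset.mem_filter, Finset.mem_range, Finset.mem_Ioc]
    grind
  · rw [Finset.disjoint_left]
    intro p
    simp only [Finset.mem_filter, Finset.mem_range, Finset.mem_Ioc]
    grind

lemma card_largePrimes_pos {n : ℕ} (hn : 2 ≤ n) : 0 < (largePrimes n).card := by
  obtain ⟨p, hp, hlt, hle⟩ := Nat.exists_prime_lt_and_le_two_mul (n / 2) (by omega)
  refine Finset.card_pos.2 ⟨p, ?_⟩
  simp only [largePrimes, Finset.mem_filter, Finset.mem_Ioc]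
  exact ⟨⟨hlt, by omega⟩, hp⟩

/-- A prime in the upper half of `{1, …, n}` is coprime to every other element. -/
lemma coprime_of_mem_largePrimes {n p m : ℕ} (hp : p ∈ largePrimes n) (hm : 0 < m) (hmn : m ≤ n)
    (hne : m ≠ p) : Nat.Coprime p m := by
  simp only [largePrimes, Finset.mem_filter, Finset.mem_Ioc] at hp
  refine (Nat.Prime.coprime_iff_not_dvd hp.2).2 ?_
  rintro ⟨q, rfl⟩
  have hq : q < 2 := by
    by_contra! h
    have := Nat.mul_le_mul_left p h
    omega
  interval_cases q <;> simp_all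

variable {V : Type*} [Fintype V] (G : SimpleGraph V)

lemma exists_adj_ne_of_two_le_degree {v : V} (h : 2 ≤ G.degree v) (w : V) :
    ∃ x, G.Adj v x ∧ x ≠ w := by
  have h1 : 1 < (G.neighborFinset v).card := by
    rw [card_neighborFinset_eq_degree]
    exact h
  obtain ⟨x, hx, hxw⟩ := Finset.exists_mem_ne h1 w
  exact ⟨x, (G.mem_neighborFinset v x).1 hx, hxw⟩

/-- If `c` has at most `k` non-neighbors other than itself, then `k` vertices different from `c`
suffice to meet the neighborhoods of `c` and of all these non-neighbors, as far as their degree is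
at least 2. -/
lemma exists_card_le_meeting_neighborhoods (c : V) {k : ℕ} (hk : 0 < k)
    (hc : Fintype.card V ≤ G.degree c + k + 1) :
    ∃ S : Finset V, c ∉ S ∧ S.card ≤ k ∧
      ∀ v, ¬ G.Adj c v → 2 ≤ G.degree v → ∃ s ∈ S, G.Adj v s := by
  have hg : ∀ v, ∃ x, 2 ≤ G.degree v → G.Adj v x := fun v => by
    by_cases h : 2 ≤ G.degree v
    · obtain ⟨x, hx, -⟩ := G.exists_adj_ne_of_two_le_degree h v
      exact ⟨x, fun _ => hx⟩
    · exact ⟨v, fun h' => absurd h' h⟩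
  choose g hg using hg
  let W : Finset V := (insert c (G.neighborFinset c))ᶜ
  have hW : ∀ v, v ∈ W ↔ v ≠ c ∧ ¬ G.Adj c v := fun v => by simp [W]
  have hWcard : W.card ≤ k := by
    have h1 : (insert c (G.neighborFinset c)).card = G.degree c + 1 := by
      rw [Finset.card_insert_of_notMem (by simp), card_neighborFinset_eq_degree]
    have h2 : W.card = Fintype.card V - (insert c (G.neighborFinset c)).card :=
      Finset.card_compl _
    omega
  let B : Finset V := W.filter fun v => 2 ≤ G.degree v
  have hB : ∀ v, v ∈ B ↔ (v ≠ c ∧ ¬ G.Adj c v) ∧ 2 ≤ G.degree v := fun v => by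
    simp [B, hW]
  have hBW : B ⊆ W := Finset.filter_subset _ _
  have hBcard : B.card ≤ k := (Finset.card_le_card hBW).trans hWcard
  have hgB : ∀ v ∈ B, G.Adj v (g v) := fun v hv => hg v ((hB v).1 hv).2
  have hgc : ∀ v ∈ B, ∀ x, G.Adj v x → x ≠ c := by
    rintro v hv x hx rfl
    exact ((hB v).1 hv).1.2 hx.symm
  by_cases hdc : 2 ≤ G.degree c
  swap
  · refine ⟨B.image g, ?_, Finset.card_image_le.trans hBcard, ?_⟩
    · simp only [Finset.mem_image, not_exists, not_and]
      exact fun v hv => hgc v hv _ (hgB v hv)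
    · intro v hv hdv
      have hvc : v ≠ c := by
        rintro rfl
        exact hdc hdv
      have hvB : v ∈ B := (hB v).2 ⟨⟨hvc, hv⟩, hdv⟩
      exact ⟨g v, Finset.mem_image_of_mem g hvB, hgB v hvB⟩
  by_cases hcross : ∃ w ∈ B, ∃ x, G.Adj w x ∧ G.Adj c x
  · obtain ⟨w, hw, x, hwx, hcx⟩ := hcross
    refine ⟨insert x ((B.erase w).image g), ?_, ?_, ?_⟩
    · simp only [Finset.mem_insert, Finset.mem_image, Finset.mem_erase, not_or, not_exists,
        not_and]
      exact ⟨hcx.ne, fun v hv => hgc v hv.2 _ (hgB v hv.2)⟩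
    · have h1 := Finset.card_insert_le x ((B.erase w).image g)
      have h2 : ((B.erase w).image g).card ≤ (B.erase w).card := Finset.card_image_le
      have h3 := Finset.card_erase_add_one hw
      omega
    · intro v hv hdv
      by_cases hvc : v = c
      · exact ⟨x, by simp, hvc ▸ hcx⟩
      by_cases hvw : v = w
      · exact ⟨x, by simp, hvw ▸ hwx⟩
      have hvB : v ∈ B := (hB v).2 ⟨⟨hvc, hv⟩, hdv⟩
      exact ⟨g v, Finset.mem_insert_of_mem
        (Finset.mem_image_of_mem g (Finset.mem_erase.2 ⟨hvw, hvB⟩)), hgB v hvB⟩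
  push Not at hcross
  have hcg := hg c hdc
  by_cases hlt : B.card < k
  · refine ⟨insert (g c) (B.image g), ?_, ?_, ?_⟩
    · simp only [Finset.mem_insert, Finset.mem_image, not_or, not_exists, not_and]
      exact ⟨hcg.ne, fun v hv => hgc v hv _ (hgB v hv)⟩
    · have h1 := Finset.card_insert_le (g c) (B.image g)
      have h2 : (B.image g).card ≤ B.card := Finset.card_image_le
      omega
    · intro v hv hdv
      by_cases hvc : v = c
      · exact ⟨g c, by simp, hvc ▸ hcg⟩
      have hvB : v ∈ B := (hB v).2 ⟨⟨hvc, hv⟩, hdv⟩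
      exact ⟨g v, Finset.mem_insert_of_mem (Finset.mem_image_of_mem g hvB), hgB v hvB⟩
  -- Now `B` is closed under adjacency, so two of its members have a common neighbor.
  have hBeq : B = W := Finset.eq_of_subset_of_card_le hBW (by omega)
  have hclosed : ∀ v ∈ B, ∀ x, G.Adj v x → x ∈ B := fun v hv x hx => by
    rw [hBeq, hW]
    exact ⟨hgc v hv x hx, hcross v hv x hx⟩
  obtain ⟨w, hw⟩ : B.Nonempty := Finset.card_pos.1 (by omega)
  have hwa := hgB w hw
  have haB := hclosed w hw _ hwa
  obtain ⟨w', haw', hne⟩ := G.exists_adj_ne_of_two_le_degree ((hB _).1 haB).2 w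
  have hw' := hclosed _ haB w' haw'
  refine ⟨insert (g c) ((B.erase w').image g), ?_, ?_, ?_⟩
  · simp only [Finset.mem_insert, Finset.mem_image, Finset.mem_erase, not_or, not_exists,
      not_and]
    exact ⟨hcg.ne, fun v hv => hgc v hv.2 _ (hgB v hv.2)⟩
  · have h1 := Finset.card_insert_le (g c) ((B.erase w').image g)
    have h2 : ((B.erase w').image g).card ≤ (B.erase w').card := Finset.card_image_le
    have h3 := Finset.card_erase_add_one hw'
    omega
  · intro v hv hdv
    by_cases hvc : v = c
    · exact ⟨g c, by simp, hvc ▸ hcg⟩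
    by_cases hvw : v = w'
    · exact ⟨g w, Finset.mem_insert_of_mem
        (Finset.mem_image_of_mem g (Finset.mem_erase.2 ⟨hne.symm, hw⟩)), hvw ▸ haw'.symm⟩
    have hvB : v ∈ B := (hB v).2 ⟨⟨hvc, hv⟩, hdv⟩
    exact ⟨g v, Finset.mem_insert_of_mem
      (Finset.mem_image_of_mem g (Finset.mem_erase.2 ⟨hvw, hvB⟩)), hgB v hvB⟩

/-- There is a bijective labeling by `{1, …, n}` giving `c` the label 1 and the members of `S`
labels that are primes in the upper half. -/
lemma exists_labeling {c : V} {S : Finset V} (hcS : c ∉ S)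
    (hS : S.card ≤ (largePrimes (Fintype.card V)).card) :
    ∃ f : V ≃ Fin (Fintype.card V), (f c : ℕ) = 0 ∧
      ∀ s ∈ S, (f s : ℕ) + 1 ∈ largePrimes (Fintype.card V) := by
  have hpos : 0 < Fintype.card V := Fintype.card_pos_iff.2 ⟨c⟩
  obtain ⟨e⟩ : Nonempty (S ↪ largePrimes (Fintype.card V)) :=
    Function.Embedding.nonempty_of_card_le (by simpa using hS)
  have hmem : ∀ p ∈ largePrimes (Fintype.card V), 2 ≤ p ∧ p ≤ Fintype.card V := fun p hp => by
    simp only [largePrimes, Finset.mem_filter, Finset.mem_Ioc] at hp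
    exact ⟨hp.2.two_le, hp.1.2⟩
  let l : V → ℕ := fun v => if h : v ∈ S then (e ⟨v, h⟩ : ℕ) - 1 else 0
  have hl : ∀ v (h : v ∈ S), l v + 1 = (e ⟨v, h⟩ : ℕ) := fun v h => by
    have := hmem _ (e ⟨v, h⟩).2
    simp only [l, h, dif_pos]
    omega
  have hlc : l c = 0 := by simp [l, hcS]
  have hlS : ∀ v ∈ S, l v ≠ 0 := fun v h => by
    have := hl v h
    have := hmem _ (e ⟨v, h⟩).2
    omega
  have hlt : ∀ v ∈ insert c S, l v ∈ Finset.range (Fintype.card V) := fun v hv => by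
    rw [Finset.mem_range]
    rcases Finset.mem_insert.1 hv with rfl | h
    · omega
    · have := hl v h
      have := hmem _ (e ⟨v, h⟩).2
      omega
  have hinj : Set.InjOn l (insert c S : Finset V) := by
    intro x hx y hy hxy
    rcases Finset.mem_insert.1 hx with rfl | hx' <;> rcases Finset.mem_insert.1 hy with rfl | hy'
    · rfl
    · exact absurd (hxy.symm.trans hlc) (hlS y hy')
    · exact absurd (hxy.trans hlc) (hlS x hx')
    · have h : (e ⟨x, hx'⟩ : ℕ) = e ⟨y, hy'⟩ := by rw [← hl, ← hl, hxy]
      simpa using e.injective (Subtype.ext h)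
  obtain ⟨f, hf⟩ := Finset.exists_equiv_extend_of_card_eq (Finset.card_range _).symm
    (Finset.image_subset_iff.2 hlt) hinj
  refine ⟨f.trans (Fin.equivSubtype.trans
    (Equiv.subtypeEquivRight fun _ => Finset.mem_range.symm)).symm, ?_, fun s hs => ?_⟩
  · exact (hf c (Finset.mem_insert_self _ _)).trans hlc
  · have h : (f s : ℕ) + 1 = e ⟨s, hs⟩ := by
      rw [hf s (Finset.mem_insert_of_mem hs), hl s hs]
    exact h ▸ (e ⟨s, hs⟩).2

end SimpleGraph

/-- Let G be a simple graph of order n ≥ 6.  If the maximum degree of G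
satisfies Δ(G) ≥ n − π(n) + π(⌊n/2⌋) − 1, where π is the prime counting function, then G is
neighborhood-prime. -/
theorem large_maxDegree_isNeighborhoodPrime {V : Type*} [Fintype V] (G : SimpleGraph V)
    (hn : 6 ≤ Fintype.card V)
    (hdeg : Fintype.card V - Nat.primeCounting (Fintype.card V)
        + Nat.primeCounting (Fintype.card V / 2) - 1 ≤ G.maxDegree) :
    G.IsNeighborhoodPrime := by
  have hcard := SimpleGraph.card_largePrimes (Fintype.card V)
  have hpos := SimpleGraph.card_largePrimes_pos (n := Fintype.card V) (by omega)
  have : Nonempty V := Fintype.card_pos_iff.1 (by omega)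
  obtain ⟨c, hc⟩ := G.exists_maximal_degree_vertex
  obtain ⟨S, hcS, hSk, hS⟩ := G.exists_card_le_meeting_neighborhoods c hpos (by omega)
  obtain ⟨f, hfc, hfS⟩ := SimpleGraph.exists_labeling hcS hSk
  refine ⟨f, fun v hv => Nat.dvd_one.1 ?_⟩
  by_cases hcv : G.Adj c v
  · simpa [hfc] using Finset.gcd_dvd (f := fun u => (f u : ℕ) + 1)
      ((G.mem_neighborFinset v c).2 hcv.symm)
  · obtain ⟨s, hs, hvs⟩ := hS v hcv hv
    obtain ⟨x, hvx, hxs⟩ := G.exists_adj_ne_of_two_le_degree hv s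
    have hcop : Nat.Coprime ((f s : ℕ) + 1) ((f x : ℕ) + 1) := by
      refine SimpleGraph.coprime_of_mem_largePrimes (hfS s hs) (by omega) (f x).isLt ?_
      intro h
      exact hxs (f.injective (Fin.ext (by omega)))
    exact (Nat.dvd_gcd (Finset.gcd_dvd (f := fun u => (f u : ℕ) + 1)
      ((G.mem_neighborFinset v s).2 hvs)) (Finset.gcd_dvd (f := fun u => (f u : ℕ) + 1)
      ((G.mem_neighborFinset v x).2 hvx))).trans hcop.gcd_eq_one.dvd
end

section
/- Let G be a simple graph. If there exists a neighborhood graph H of G that has a prime labeling, then G is neighborhood-prime. -/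
namespace SimpleGraph

/-- A *prime labeling* of a graph of order `n` is a bijective labeling of the vertices by
`{1, …, n}` such that the labels of any two adjacent vertices are coprime. -/
def HasPrimeLabeling {V : Type*} [Fintype V] (H : SimpleGraph V) : Prop :=
  ∃ f : V ≃ Fin (Fintype.card V),
    ∀ u w : V, H.Adj u w → Nat.gcd ((f u : ℕ) + 1) ((f w : ℕ) + 1) = 1

open scoped Classical in
/-- `H` is a *neighborhood graph* of `G` if they share the same vertex set and for every
vertex `v` of `G` of degree at least 2, exactly one edge of `H` has both of its endpoints
in the neighborhood `N_G(v)`. -/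
noncomputable def IsNeighborhoodGraphOf {V : Type*} [Fintype V] (H G : SimpleGraph V) : Prop :=
  ∀ v : V, 2 ≤ G.degree v → ∃! e : Sym2 V, e ∈ H.edgeSet ∧ ∀ x ∈ e, G.Adj v x

end SimpleGraph

/-- Let G be a simple graph.  If there exists a neighborhood graph H of G
that has a prime labeling, then G is neighborhood-prime. -/
theorem neighborhoodGraph_prime_isNeighborhoodPrime {V : Type*} [Fintype V]
    (G : SimpleGraph V)
    (h : ∃ H : SimpleGraph V, H.IsNeighborhoodGraphOf G ∧ H.HasPrimeLabeling) :
    G.IsNeighborhoodPrime := by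
  classical
  obtain ⟨H, hH, f, hf⟩ := h
  refine ⟨f, fun v hv => ?_⟩
  obtain ⟨e, ⟨he, hadj⟩, -⟩ := hH v hv
  induction e using Sym2.ind with
  | h u w =>
    have hu := hadj u (Sym2.mem_mk_left u w)
    have hw := hadj w (Sym2.mem_mk_right u w)
    refine Nat.eq_one_of_dvd_coprimes (hf u w he) ?_ ?_
    · exact Finset.gcd_dvd ((G.mem_neighborFinset v u).2 hu)
    · exact Finset.gcd_dvd ((G.mem_neighborFinset v w).2 hw)
end

section
/- Let G = C_{n_1} ∪ C_{n_2} ∪ ⋯ ∪ C_{n_k} be a disjoint union of cycles with each n_i ≥ 3. If some n_i ≡ 2 (mod 4), or if at least two of the cycle lengths n_i are odd, then G is not neighborhood-prime. -/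
namespace SimpleGraph

/-- The disjoint union of a family of graphs, as a graph on the sigma type: two vertices
are adjacent exactly when they lie in the same summand and are adjacent there. -/
def disjointUnion {ι : Type*} {V : ι → Type*} (G : ∀ i, SimpleGraph (V i)) :
    SimpleGraph (Σ i, V i) :=
  SimpleGraph.fromRel (fun a b =>
    ∃ (i : ι) (x y : V i), a = ⟨i, x⟩ ∧ b = ⟨i, y⟩ ∧ (G i).Adj x y)

end SimpleGraph

namespace SimpleGraph

theorem disjointUnion_adj_mk {ι : Type*} {V : ι → Type*} {G : ∀ i, SimpleGraph (V i)}
    {i : ι} {x : V i} {u : Σ i, V i} :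
    (disjointUnion G).Adj ⟨i, x⟩ u ↔ ∃ y, u = ⟨i, y⟩ ∧ (G i).Adj x y := by
  rw [disjointUnion, fromRel_adj]
  constructor
  · rintro ⟨-, ⟨j, a, b, ha, hb, hab⟩ | ⟨j, a, b, ha, hb, hab⟩⟩
    · cases ha
      exact ⟨b, hb, hab⟩
    · cases hb
      exact ⟨a, ha, hab.symm⟩
  · rintro ⟨y, rfl, hxy⟩
    exact ⟨fun he => hxy.ne (eq_of_heq (Sigma.mk.inj he).2), Or.inl ⟨i, x, y, rfl, rfl, hxy⟩⟩

theorem neighborFinset_disjointUnion_mk {ι : Type*} {V : ι → Type*} (G : ∀ i, SimpleGraph (V i))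
    (i : ι) (x : V i) [Fintype ((G i).neighborSet x)]
    [Fintype ((disjointUnion G).neighborSet ⟨i, x⟩)] :
    (disjointUnion G).neighborFinset ⟨i, x⟩ =
      ((G i).neighborFinset x).map (Function.Embedding.sigmaMk i) := by
  ext u
  simp only [mem_neighborFinset, disjointUnion_adj_mk, Finset.mem_map,
    Function.Embedding.sigmaMk_apply]
  exact exists_congr fun y => by rw [and_comm, eq_comm]

theorem cycleGraph_degree_eq_two {n : ℕ} (hn : 3 ≤ n) (x : Fin n) :
    (cycleGraph n).degree x = 2 := by
  obtain ⟨m, rfl⟩ := Nat.exists_eq_add_of_le' hn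
  exact cycleGraph_degree_three_le

open Fin.NatCast Fin.CommRing in
/-- A vertex set of a cycle containing no full neighborhood has at most half of the vertices, and
it cannot attain this bound when the length is `2` modulo `4`. -/
theorem two_mul_card_le_of_not_neighborFinset_subset {n : ℕ} (hn : 3 ≤ n) {s : Finset (Fin n)}
    (hs : ∀ v, ¬ (cycleGraph n).neighborFinset v ⊆ s) :
    2 * s.card ≤ n ∧ (n % 4 = 2 → 2 * s.card ≠ n) := by
  obtain ⟨m, rfl⟩ := Nat.exists_eq_add_of_le' hn
  set c : Fin (m + 3) → ℕ := fun x => if x ∈ s then 1 else 0 with hc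
  have hcard : ∑ x, c x = s.card := by simp [hc]
  have hsum : ∑ v, (c (v - 1) + c (v + 1)) = 2 * s.card := by
    rw [Finset.sum_add_distrib, two_mul, ← hcard]
    exact congrArg₂ (· + ·) (Equiv.sum_comp (Equiv.subRight 1) c)
      (Equiv.sum_comp (Equiv.addRight 1) c)
  have hle : ∀ v ∈ Finset.univ, c (v - 1) + c (v + 1) ≤ 1 := by
    intro v _
    have := hs v
    rw [cycleGraph_neighborFinset, Finset.insert_subset_iff, Finset.singleton_subset_iff] at this
    simp only [hc]
    split_ifs <;> tauto
  have hone : ∑ _v : Fin (m + 3), 1 = m + 3 := by simp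
  refine ⟨by simpa only [hsum, hone] using Finset.sum_le_sum hle, fun hmod heq => ?_⟩
  have hstep : ∀ x, x + 2 ∈ s ↔ x ∉ s := by
    intro x
    have := (Finset.sum_eq_sum_iff_of_le hle).1 (by rw [hsum, hone, heq]) (x + 1)
      (Finset.mem_univ _)
    rw [add_sub_cancel_right, add_assoc, one_add_one_eq_two] at this
    simp only [hc] at this
    split_ifs at this <;> simp_all
  have hiter : ∀ k : ℕ, ((2 * k : ℕ) : Fin (m + 3)) ∈ s ↔ (0 ∈ s ↔ Even k) := by
    intro k
    induction k with
    | zero => simp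
    | succ k ih =>
      rw [mul_add_one, Nat.cast_add, Nat.cast_two, hstep, ih, Nat.even_add_one]
      tauto
  have := hiter ((m + 3) / 2)
  rw [show 2 * ((m + 3) / 2) = m + 3 by omega, Fin.natCast_self, Nat.even_iff] at this
  have : (m + 3) / 2 % 2 ≠ 0 := by omega
  tauto

/-- In a neighborhood-prime labeling of a disjoint union of cycles, no neighborhood consists of
even labels only. -/
theorem not_neighborFinset_subset_filter_two_dvd {ι : Type*} [Fintype ι] {n : ι → ℕ}
    (hn : ∀ i, 3 ≤ n i) {f : (Σ i, Fin (n i)) → ℕ}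
    [DecidableRel (disjointUnion fun i => cycleGraph (n i)).Adj]
    (hf : ∀ v, 2 ≤ (disjointUnion fun i => cycleGraph (n i)).degree v →
      ((disjointUnion fun i => cycleGraph (n i)).neighborFinset v).gcd f = 1)
    (i : ι) (x : Fin (n i)) :
    ¬ (cycleGraph (n i)).neighborFinset x ⊆ Finset.univ.filter fun y => 2 ∣ f ⟨i, y⟩ := by
  intro hsub
  have hN := neighborFinset_disjointUnion_mk (fun i => cycleGraph (n i)) i x
  have hdeg : (cycleGraph (n i)).degree x = 2 := cycleGraph_degree_eq_two (hn i) x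
  have hgcd := hf ⟨i, x⟩ <| by
    rw [← card_neighborFinset_eq_degree, hN, Finset.card_map, card_neighborFinset_eq_degree, hdeg]
  have hdvd : 2 ∣ ((disjointUnion fun i => cycleGraph (n i)).neighborFinset ⟨i, x⟩).gcd f := by
    rw [hN]
    refine Finset.dvd_gcd fun u hu => ?_
    obtain ⟨y, hy, rfl⟩ := Finset.mem_map.1 hu
    exact (Finset.mem_filter.1 (hsub hy)).2
  omega

end SimpleGraph

theorem card_filter_two_dvd_val_add_one {V : Type*} [Fintype V] {n : ℕ} (f : V ≃ Fin n) :
    (Finset.univ.filter fun v => 2 ∣ (f v : ℕ) + 1).card = n / 2 := by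
  rw [← Nat.card_multiples, Finset.card_filter, Finset.card_filter,
    ← Fin.sum_univ_eq_sum_range (fun j => if 2 ∣ j + 1 then 1 else 0)]
  exact f.sum_comp fun j => if 2 ∣ (j : ℕ) + 1 then 1 else 0

/-- Let G = C_{n_1} ∪ C_{n_2} ∪ ⋯ ∪ C_{n_k} be a disjoint union of cycles
with each n_i ≥ 3.  If some n_i ≡ 2 (mod 4), or if at least two of the cycle lengths n_i
are odd, then G is not neighborhood-prime. -/
theorem unionOfCycles_not_isNeighborhoodPrime (k : ℕ) (nl : Fin k → ℕ)
    (h3 : ∀ i, 3 ≤ nl i)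
    (h : (∃ i, nl i % 4 = 2) ∨ (∃ i j, i ≠ j ∧ Odd (nl i) ∧ Odd (nl j))) :
    ¬ (SimpleGraph.disjointUnion
        (fun i : Fin k => SimpleGraph.cycleGraph (nl i))).IsNeighborhoodPrime := by
  classical
  rintro ⟨f, hf⟩
  set s : ∀ i, Finset (Fin (nl i)) := fun i =>
    Finset.univ.filter fun y => 2 ∣ (f ⟨i, y⟩ : ℕ) + 1
  have hs : ∀ i, 2 * (s i).card ≤ nl i ∧ (nl i % 4 = 2 → 2 * (s i).card ≠ nl i) := fun i =>
    SimpleGraph.two_mul_card_le_of_not_neighborFinset_subset (h3 i) fun x =>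
      SimpleGraph.not_neighborFinset_subset_filter_two_dvd h3
        (f := fun v => (f v : ℕ) + 1) (by convert hf) i x
  have hcard : Fintype.card (Σ i, Fin (nl i)) = ∑ i, nl i := by simp
  have hcount : ∑ i, (s i).card = (∑ i, nl i) / 2 := by
    rw [← hcard, ← card_filter_two_dvd_val_add_one f]
    simp only [s, Finset.card_filter, Fintype.sum_sigma]
  have hsum : ∑ i, nl i = 2 * ∑ i, (s i).card + ∑ i, (nl i - 2 * (s i).card) := by
    rw [Finset.mul_sum, ← Finset.sum_add_distrib]
    exact Finset.sum_congr rfl fun i _ => (Nat.add_sub_of_le (hs i).1).symm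
  suffices 2 ≤ ∑ i, (nl i - 2 * (s i).card) by omega
  rcases h with ⟨i, hi⟩ | ⟨i, j, hij, hi, hj⟩
  · refine le_trans ?_ (Finset.single_le_sum (fun _ _ => Nat.zero_le _) (Finset.mem_univ i))
    have := (hs i).1
    have := (hs i).2 hi
    omega
  · refine le_trans ?_ (Finset.add_le_sum (fun _ _ => Nat.zero_le _) (Finset.mem_univ i)
      (Finset.mem_univ j) hij)
    have := (hs i).1
    have := (hs j).1
    rw [Nat.odd_iff] at hi hj
    omega
end
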